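/- Let R be a commutative ring containing the field of rational numbers, let φ : R^m → R^n be an R-linear map, let d ≥ 1, and let r ≥ 1. Let Σ be the set of minimal elements, with respect to the partial order on Young diagrams, among the shapes of the monomials generating the monomial ideal I_r(S^d(Y)), where Y is a diagonal matrix of indeterminates of the same format as φ. Then I_r(S^d(φ)) ⊆ Σ_{σ ∈ Σ} I^σ(φ). -/

import Mathlib

noncomputable section

/-- `I_t(A)`: the ideal of `R` generated by the `t × t` minors of the matrix `A`. -/
def minorsIdeal {R : Type*} [CommRing R] (t : ℕ) {N M : Type*} (A : Matrix N M R) : Ideal R :=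
  Ideal.span {x : R | ∃ (r : Fin t → N) (c : Fin t → M), x = (A.submatrix r c).det}

/-- The matrix (in the standard bases of monomials) of the `d`-th symmetric power
`S^d(φ) : S^d(R^m) → S^d(R^n)` of the linear map `φ : R^m → R^n` given by the
`n × m` matrix `A`: the `(μ, ν)` entry is the coefficient of the monomial `x^μ` in
`Π_{j ∈ ν} φ(x_j)`, computed in the symmetric algebra `R[x_1, …, x_n]` of `R^n`. -/
def symPowMatrix {R : Type*} [CommRing R] {m n : ℕ} (d : ℕ) (A : Matrix (Fin n) (Fin m) R) :
    Matrix (Sym (Fin n) d) (Sym (Fin m) d) R := fun μ ν =>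
  MvPolynomial.coeff (Multiset.toFinsupp (μ : Multiset (Fin n)))
    (((ν : Multiset (Fin m)).map fun j =>
        ∑ i : Fin n, MvPolynomial.C (A i j) * MvPolynomial.X i).prod)

/-- A Young diagram `σ = (s_1, …, s_u)`, recorded as the multiset of its (positive) parts. -/
def IsYoungDiagram (σ : Multiset ℕ) : Prop := ∀ s ∈ σ, 0 < s

/-- `γ_j(σ) = Σ_i max (0, s_i - j + 1)` (written with truncated subtraction). -/
def youngGamma (σ : Multiset ℕ) (j : ℕ) : ℕ := (σ.map fun s => s + 1 - j).sum

/-- The partial order on Young diagrams: `σ ≤ τ` iff `γ_j σ ≤ γ_j τ` for all `j ≥ 1`. -/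
def YoungLE (σ τ : Multiset ℕ) : Prop := ∀ j, 1 ≤ j → youngGamma σ j ≤ youngGamma τ j

/-- `I^σ(A) = Π_i I_{s_i}(A)`. -/
def prodMinorsIdeal {R : Type*} [CommRing R] {N M : Type*} (A : Matrix N M R)
    (σ : Multiset ℕ) : Ideal R := (σ.map fun s => minorsIdeal s A).prod

/-- The shape of the monomial with exponent vector `e`: writing the monomial `f` as
`f = f_1 ⋯ f_u` with each `f_i` squarefree and `f_{i+1} ∣ f_i`, the shape is
`(deg f_1, …, deg f_u)`, where `deg f_i = #{j | e j ≥ i}`. -/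
def monomialShape {k : ℕ} (e : Fin k →₀ ℕ) : Multiset ℕ :=
  Multiset.filter (fun c => 0 < c)
    ((Multiset.range (e.sum fun _ v => v)).map fun i =>
      (Finset.univ.filter fun j => i + 1 ≤ e j).card)

/-- `I^{(σ)}(A) = Σ_{τ ≥ σ} I^τ(A)`, the sum over all Young diagrams `τ ≥ σ`. -/
def sumProdMinorsIdeal {R : Type*} [CommRing R] {N M : Type*} (A : Matrix N M R)
    (σ : Multiset ℕ) : Ideal R :=
  ⨆ (τ : Multiset ℕ) (_ : IsYoungDiagram τ ∧ YoungLE σ τ), prodMinorsIdeal A τ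

/-- The `n × m` diagonal matrix whose diagonal entries are independent indeterminates
`Y_1, …, Y_{min n m}` over `ℤ` (and whose other entries are zero). -/
def diagIndetMatrix (n m : ℕ) : Matrix (Fin n) (Fin m) (MvPolynomial (Fin (min n m)) ℤ) :=
  fun i j => if h : (i : ℕ) = (j : ℕ) then
      MvPolynomial.X ⟨(i : ℕ), lt_min i.isLt (h ▸ j.isLt)⟩
    else 0

/-- The set of shapes of the monomials lying in the monomial ideal `I_r(S^d(Y))`,
where `Y` is an `n × m` diagonal matrix of indeterminates over `ℤ`. -/
def shapesOfSymPowMinors (n m d r : ℕ) : Set (Multiset ℕ) :=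
  {σ | ∃ e : Fin (min n m) →₀ ℕ,
      MvPolynomial.monomial e (1 : ℤ) ∈ minorsIdeal r (symPowMatrix d (diagIndetMatrix n m)) ∧
      σ = monomialShape e}

/-- `Σ`: the set of minimal elements, with respect to the partial order on Young diagrams,
among the shapes of the monomials generating the monomial ideal `I_r(S^d(Y))`. -/
def minimalShapes (n m d r : ℕ) : Set (Multiset ℕ) :=
  {σ ∈ shapesOfSymPowMinors n m d r |
    ∀ τ ∈ shapesOfSymPowMinors n m d r, YoungLE τ σ → τ = σ}

section SwapEigen

open Equiv

variable {X V : Type*} [DecidableEq X] [AddCommGroup V] [Module ℚ V]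

/-- `v` is multiplied by `s` under every transposition of two elements of `S`. -/
def SwapEigen (ρ : Representation ℚ (Perm X) V) (s : ℚ) (S : Finset X) (v : V) : Prop :=
  ∀ x ∈ S, ∀ y ∈ S, x ≠ y → ρ (swap x y) v = s • v

/-- Up to a scalar, the (signed) symmetrization over `insert z S` of a vector which is already
(signed) symmetric over `S`. -/
def addBox (ρ : Representation ℚ (Perm X) V) (s : ℚ) (S : Finset X) (z : X) (v : V) : V :=
  v + s • ∑ y ∈ S, ρ (swap z y) v

/-- An invariant positive definite symmetric form. -/
structure IsInvariantInner (ρ : Representation ℚ (Perm X) V) (B : V →ₗ[ℚ] V →ₗ[ℚ] ℚ) : Prop where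
  invariant : ∀ g v w, B (ρ g v) (ρ g w) = B v w
  symm : ∀ v w, B v w = B w v
  pos : ∀ v, v ≠ 0 → 0 < B v v

variable {ρ : Representation ℚ (Perm X) V} {B : V →ₗ[ℚ] V →ₗ[ℚ] ℚ}

omit [DecidableEq X] in
lemma IsInvariantInner.nonneg (hB : IsInvariantInner ρ B) (v : V) : 0 ≤ B v v := by
  rcases eq_or_ne v 0 with rfl | h
  · simp
  · exact (hB.pos v h).le

lemma IsInvariantInner.swap_left (hB : IsInvariantInner ρ B) (x y : X) (v w : V) :
    B (ρ (swap x y) v) w = B v (ρ (swap x y) w) := by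
  rw [← hB.invariant (swap x y) v, ← Module.End.mul_apply, ← map_mul, swap_mul_self, map_one,
    Module.End.one_apply]

lemma SwapEigen.mono {s : ℚ} {S T : Finset X} {v : V} (h : SwapEigen ρ s T v) (hST : S ⊆ T) :
    SwapEigen ρ s S v :=
  fun x hx y hy hxy => h x (hST hx) y (hST hy) hxy

lemma SwapEigen.of_card_le_one {s : ℚ} {S : Finset X} {v : V} (h : S.card ≤ 1) :
    SwapEigen ρ s S v :=
  fun x hx y hy hxy => absurd (Finset.card_le_one.mp h x hx y hy) hxy

lemma SwapEigen.addBox_insert {s : ℚ} (hs : s * s = 1) {S : Finset X} {z : X} (hz : z ∉ S) {v : V}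
    (h : SwapEigen ρ s S v) : SwapEigen ρ s (insert z S) (addBox ρ s S z v) := by
  have key : ∀ y ∈ S, ρ (swap z y) (addBox ρ s S z v) = s • addBox ρ s S z v := by
    intro y hy
    have hzy : z ≠ y := fun e => hz (e ▸ hy)
    rw [addBox, ← Finset.add_sum_erase S _ hy, map_add, map_smul, map_add, map_sum]
    have h1 : ρ (swap z y) (ρ (swap z y) v) = v := by
      rw [← Module.End.mul_apply, ← map_mul, swap_mul_self, map_one, Module.End.one_apply]
    have h2 : ∀ x ∈ S.erase y, ρ (swap z y) (ρ (swap z x) v) = s • ρ (swap z x) v := by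
      intro x hx
      have hx' := Finset.mem_erase.mp hx
      have hzx : z ≠ x := fun e => hz (e ▸ hx'.2)
      have : swap z y * swap z x = swap z x * swap x y := by
        rw [Equiv.mul_swap_eq_swap_mul (swap z x), swap_apply_right,
          swap_apply_of_ne_of_ne hzy.symm hx'.1.symm]
      rw [← Module.End.mul_apply, ← map_mul, this, map_mul, Module.End.mul_apply,
        h x hx'.2 y hy hx'.1, map_smul]
    rw [h1, Finset.sum_congr rfl h2, ← Finset.smul_sum]
    simp only [smul_add, smul_smul, hs, one_smul]
    abel
  intro x hx y hy hxy
  rw [Finset.mem_insert] at hx hy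
  rcases hx with rfl | hx
  · exact key y (hy.resolve_left hxy.symm)
  rcases hy with rfl | hy
  · rw [swap_comm]; exact key x hx
  · have hzx : z ≠ x := fun e => hz (e ▸ hx)
    have hzy : z ≠ y := fun e => hz (e ▸ hy)
    have : swap x y = swap z x * swap z y * swap z x := by
      rw [Equiv.mul_swap_eq_swap_mul (swap z x), swap_apply_left, mul_assoc,
        swap_apply_of_ne_of_ne hzy.symm hxy.symm, swap_mul_self, mul_one]
    rw [this, map_mul, map_mul, Module.End.mul_apply, Module.End.mul_apply, key x hx, map_smul,
      key y hy, smul_smul, hs, one_smul, key x hx]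

lemma SwapEigen.addBox_of_disjoint {s s' : ℚ} {S T : Finset X} {z : X} {v : V}
    (h : SwapEigen ρ s' T v) (hd : ∀ x ∈ T, x ≠ z ∧ x ∉ S) :
    SwapEigen ρ s' T (addBox ρ s S z v) := by
  intro x hx y hy hxy
  suffices ∀ a ∈ S, ρ (swap x y) (ρ (swap z a) v) = s' • ρ (swap z a) v by
    rw [addBox, map_add, h x hx y hy hxy, map_smul, map_sum, smul_add, smul_comm s' s,
      Finset.sum_congr rfl this, ← Finset.smul_sum]
  intro a ha
  have : swap x y * swap z a = swap z a * swap x y := by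
    rw [Equiv.mul_swap_eq_swap_mul, swap_apply_of_ne_of_ne (hd x hx).1.symm (hd y hy).1.symm,
      swap_apply_of_ne_of_ne]
    · rintro rfl; exact (hd _ hx).2 ha
    · rintro rfl; exact (hd _ hy).2 ha
  rw [← Module.End.mul_apply, ← map_mul, this, map_mul, Module.End.mul_apply,
    h x hx y hy hxy, map_smul]

lemma SwapEigen.addBox_self {s : ℚ} (hs : s * s = 1) {S : Finset X} {z : X} (hz : z ∉ S) {v : V}
    (h : SwapEigen ρ s (insert z S) v) : addBox ρ s S z v = (1 + (S.card : ℚ)) • v := by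
  have : ∀ y ∈ S, ρ (swap z y) v = s • v := fun y hy =>
    h z (Finset.mem_insert_self _ _) y (Finset.mem_insert_of_mem hy) fun e => hz (e ▸ hy)
  rw [addBox, Finset.sum_congr rfl this, Finset.sum_const, ← Nat.cast_smul_eq_nsmul ℚ, smul_smul,
    smul_smul, add_smul, one_smul, mul_right_comm, hs, one_mul]

lemma IsInvariantInner.addBox_left (hB : IsInvariantInner ρ B) (s : ℚ) (S : Finset X) (z : X)
    (v w : V) : B (addBox ρ s S z v) w = B v (addBox ρ s S z w) := by
  simp only [addBox, map_add, map_smul, map_sum, LinearMap.add_apply, LinearMap.smul_apply,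
    LinearMap.sum_apply, hB.swap_left]

lemma IsInvariantInner.addBox_inner_self (hB : IsInvariantInner ρ B) {s : ℚ} (hs : s * s = 1)
    {S : Finset X} {z : X} (hz : z ∉ S) {v : V} (h : SwapEigen ρ s S v) :
    B (addBox ρ s S z v) (addBox ρ s S z v) = (1 + (S.card : ℚ)) * B (addBox ρ s S z v) v := by
  rw [← hB.addBox_left, SwapEigen.addBox_self hs hz (h.addBox_insert hs hz)]
  simp

/-- Moving a box from a longer column to a shorter one preserves the existence of an alternating
vector. -/
lemma exists_addBox_ne_zero (hB : IsInvariantInner ρ B) {P Q : Finset X} (hPQ : Disjoint P Q)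
    (hlt : Q.card < P.card) {v : V} (hv : v ≠ 0) (hP : SwapEigen ρ (-1) P v) :
    ∃ z ∈ P, addBox ρ (-1) Q z v ≠ 0 := by
  by_contra! hcon
  have h1 : ∑ z ∈ P, B (addBox ρ (-1) Q z v) v = 0 :=
    Finset.sum_eq_zero fun z hz => by rw [hcon z hz]; simp
  have h2 : 0 ≤ ∑ y ∈ Q, B (addBox ρ (-1) P y v) v := by
    refine Finset.sum_nonneg fun y hy => ?_
    have := hB.addBox_inner_self (s := -1) (by norm_num)
      (Finset.disjoint_right.mp hPQ hy) hP
    have h3 := hB.nonneg (addBox ρ (-1) P y v)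
    rw [this] at h3
    exact nonneg_of_mul_nonneg_right h3 (by positivity)
  have h4 : ∀ (P Q : Finset X), ∑ z ∈ P, B (addBox ρ (-1) Q z v) v =
      P.card * B v v - ∑ z ∈ P, ∑ y ∈ Q, B (ρ (swap z y) v) v := by
    intro P Q
    simp [addBox, Finset.sum_add_distrib, sub_eq_add_neg]
  rw [h4] at h1 h2
  rw [Finset.sum_comm] at h2
  simp only [swap_comm] at h1 h2
  have h5 : ∑ y ∈ P, ∑ x ∈ Q, B (ρ (swap x y) v) v = ∑ y ∈ P, ∑ x ∈ Q, B (ρ (swap y x) v) v := by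
    simp only [swap_comm]
  have hpos := hB.pos v hv
  have hlt' : (Q.card : ℚ) < P.card := by exact_mod_cast hlt
  nlinarith

end SwapEigen

section RowSymmetrization

open Equiv

variable {X V : Type*} [DecidableEq X] [AddCommGroup V] [Module ℚ V]
  {ρ : Representation ℚ (Perm X) V} {B : V →ₗ[ℚ] V →ₗ[ℚ] ℚ}

/-- Successive antisymmetrization of `v` over the elements of a list. -/
def antisymList (ρ : Representation ℚ (Perm X) V) (v : V) : List X → V
  | [] => v
  | x :: xs => addBox ρ (-1) xs.toFinset x (antisymList ρ v xs)

/-- The product of the transpositions given by a list of pairs. -/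
def swapList : List (X × X) → Perm X
  | [] => 1
  | a :: l => swapList l * swap a.1 a.2

lemma swapList_apply_of_notMem : ∀ (l : List (X × X)) (z : X), z ∉ l.map Prod.fst →
    z ∉ l.map Prod.snd → swapList l z = z
  | [], z, _, _ => rfl
  | a :: l, z, h1, h2 => by
    simp only [List.map_cons, List.mem_cons, not_or] at h1 h2
    rw [swapList, Perm.mul_apply, swap_apply_of_ne_of_ne h1.1 h2.1,
      swapList_apply_of_notMem l z h1.2 h2.2]

lemma swapList_apply_snd : ∀ (l : List (X × X)), (l.map Prod.fst).Nodup → (l.map Prod.snd).Nodup →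
    (∀ a ∈ l, ∀ b ∈ l, a.1 ≠ b.2) → ∀ a ∈ l, swapList l a.2 = a.1
  | [], _, _, _, a, ha => by simp at ha
  | b :: l, h1, h2, h3, a, ha => by
    rw [List.map_cons, List.nodup_cons] at h1 h2
    rw [swapList, Perm.mul_apply]
    rcases List.mem_cons.mp ha with rfl | ha
    · rw [swap_apply_right]
      refine swapList_apply_of_notMem l _ h1.1 ?_
      rw [List.mem_map]
      rintro ⟨c, hc, hca⟩
      exact h3 a (by simp) c (List.mem_cons_of_mem _ hc) hca.symm
    · rw [swap_apply_of_ne_of_ne]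
      · exact swapList_apply_snd l h1.2 h2.2 (fun c hc d hd => h3 c (List.mem_cons_of_mem _ hc) d
          (List.mem_cons_of_mem _ hd)) a ha
      · exact (h3 b (by simp) a (List.mem_cons_of_mem _ ha)).symm
      · rintro e
        exact h2.1 (e ▸ List.mem_map_of_mem ha)

lemma antisymList_swapEigen (v : V) : ∀ xs : List X, xs.Nodup →
    SwapEigen ρ (-1) xs.toFinset (antisymList ρ v xs)
  | [], _ => fun x hx => by simp at hx
  | x :: xs, h => by
    rw [List.nodup_cons] at h
    rw [List.toFinset_cons, antisymList]
    exact (antisymList_swapEigen v xs h.2).addBox_insert (by norm_num) (by simpa using h.1)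

lemma IsInvariantInner.antisymList_inner (hB : IsInvariantInner ρ B) (v u : V) :
    ∀ xs : List X, xs.Nodup → SwapEigen ρ (-1) xs.toFinset u →
      B (antisymList ρ v xs) u = (xs.length.factorial : ℚ) * B v u
  | [], _, _ => by simp [antisymList]
  | x :: xs, h, hu => by
    rw [List.nodup_cons] at h
    rw [List.toFinset_cons] at hu
    rw [antisymList, hB.addBox_left, hu.addBox_self (by norm_num) (by simpa using h.1), map_smul,
      hB.antisymList_inner v u xs h.2 (hu.mono (Finset.subset_insert _ _)),
      List.toFinset_card_of_nodup h.2, List.length_cons, Nat.factorial_succ, smul_eq_mul]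
    push_cast; ring

lemma IsInvariantInner.antisymList_inner_nonneg (hB : IsInvariantInner ρ B) (v : V) (xs : List X)
    (h : xs.Nodup) : 0 ≤ B (antisymList ρ v xs) v := by
  have := hB.antisymList_inner v _ xs h (antisymList_swapEigen v xs h)
  have h2 := hB.nonneg (antisymList ρ v xs)
  rw [this, hB.symm v] at h2
  exact nonneg_of_mul_nonneg_right h2 (by positivity)

/-- A consequence of the Garnir relations between a column `C` and the elements of `Z`. -/
lemma IsInvariantInner.swapList_inner (hB : IsInvariantInner ρ B) {C Z : Finset X}
    (hCZ : Disjoint C Z) {v : V} (hC : SwapEigen ρ (-1) C v)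
    (hG : ∀ x ∈ Z, ∑ y ∈ C, ρ (swap x y) v = v) :
    ∀ l : List (X × X), (l.map Prod.fst).Nodup → (l.map Prod.snd).Nodup →
      (∀ a ∈ l, a.1 ∈ Z ∧ a.2 ∈ C) → ∃ c : ℚ, 0 < c ∧ ∀ w, SwapEigen ρ (-1) C w →
        c * B (ρ (swapList l) v) w = B (antisymList ρ v (l.map Prod.fst)) w
  | [], _, _, _ => ⟨1, one_pos, fun w _ => by simp [swapList, antisymList]⟩
  | (x, y) :: l, h1, h2, h3 => by
    simp only [List.map_cons, List.nodup_cons] at h1 h2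
    have h3' : ∀ a ∈ l, a.1 ∈ Z ∧ a.2 ∈ C := fun a ha => h3 a (List.mem_cons_of_mem _ ha)
    obtain ⟨hx, hy⟩ : x ∈ Z ∧ y ∈ C := h3 (x, y) (by simp)
    obtain ⟨c, hc, ih⟩ := hB.swapList_inner hCZ hC hG l h1.2 h2.2 h3'
    have hne : ∀ a ∈ Z, ∀ b ∈ C, a ≠ b := fun a ha b hb e => Finset.disjoint_left.mp hCZ hb (e ▸ ha)
    set Y := (l.map Prod.snd).toFinset with hY
    have hYC : Y ⊆ C := by
      intro b hb
      simp only [hY, List.mem_toFinset, List.mem_map] at hb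
      obtain ⟨a, ha, rfl⟩ := hb
      exact (h3' a ha).2
    have hxZ : ∀ b ∈ l.map Prod.fst, b ∈ Z := by
      intro b hb
      obtain ⟨a, ha, rfl⟩ := List.mem_map.mp hb
      exact (h3' a ha).1
    have hyY : y ∈ C \ Y := by simp [hY, hy, h2.1]
    have hDx : swapList l x = x := swapList_apply_of_notMem l x h1.1 fun h =>
      hne x hx x (hYC (by simpa [hY] using h)) rfl
    have hD : ∀ b ∈ C \ Y, swapList l b = b := fun b hb => by
      rw [Finset.mem_sdiff] at hb
      exact swapList_apply_of_notMem l b (fun h => hne b (hxZ b h) b hb.1 rfl)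
        (by simpa [hY] using hb.2)
    have hsnd := swapList_apply_snd l h1.2 h2.2
      (fun a ha b hb => hne _ (h3' a ha).1 _ (h3' b hb).2)
    refine ⟨c * (C \ Y).card, mul_pos hc (by exact_mod_cast Finset.card_pos.mpr ⟨y, hyY⟩),
      fun w hw => ?_⟩
    have hw' : SwapEigen ρ (-1) C (addBox ρ (-1) (l.map Prod.fst).toFinset x w) :=
      hw.addBox_of_disjoint fun b hb => ⟨(hne x hx b hb).symm, fun h =>
        hne b (hxZ b (by simpa using h)) b hb rfl⟩
    rw [List.map_cons, antisymList, hB.addBox_left, ← ih _ hw', mul_assoc]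
    congr 1
    -- the terms with `b ∉ Y` do not depend on `b`
    have hout : ∀ b ∈ C \ Y, B (ρ (swapList l * swap x b) v) w =
        B (ρ (swapList l * swap x y) v) w := by
      intro b hb
      rcases eq_or_ne b y with rfl | hby
      · rfl
      have hbC := (Finset.mem_sdiff.mp hb).1
      have e : swapList l * swap x b = swap b y * (swapList l * swap x y) * swap b y := by
        have e1 : swap b y * swapList l = swapList l * swap b y := by
          rw [Equiv.mul_swap_eq_swap_mul, hD b hb, hD y hyY]
        have e2 : swap b y * swap x y = swap x b * swap b y := by
          rw [Equiv.mul_swap_eq_swap_mul, swap_apply_right,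
            swap_apply_of_ne_of_ne (hne x hx b hbC) (hne x hx y hy)]
        rw [← mul_assoc, e1, mul_assoc, mul_assoc, ← mul_assoc (swap b y) (swap x y), e2, mul_assoc, swap_mul_self, mul_one]
      rw [e, map_mul, map_mul, Module.End.mul_apply, Module.End.mul_apply, hC b hbC y hy hby,
        hB.swap_left, hw b hbC y hy hby]
      simp
    have hin : ∑ b ∈ Y, B (ρ (swapList l * swap x b) v) w =
        ∑ a ∈ (l.map Prod.fst).toFinset, B (ρ (swap x a) (ρ (swapList l) v)) w := by
      rw [hY, List.sum_toFinset _ h2.2, List.sum_toFinset _ h1.2, List.map_map, List.map_map]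
      congr 1
      refine List.map_congr_left fun a ha => ?_
      simp only [Function.comp_apply]
      rw [Equiv.mul_swap_eq_swap_mul, hDx, hsnd a ha, map_mul, Module.End.mul_apply]
    have htot : ∑ b ∈ C, B (ρ (swapList l * swap x b) v) w = B (ρ (swapList l) v) w := by
      conv_rhs => rw [← hG x hx]
      simp [map_sum]
    rw [← Finset.sum_sdiff hYC, Finset.sum_congr rfl hout, Finset.sum_const, hin,
      nsmul_eq_mul] at htot
    rw [swapList, ← hB.addBox_left, addBox]
    simp only [map_add, map_smul, LinearMap.add_apply, LinearMap.smul_apply, map_sum,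
      LinearMap.sum_apply, smul_eq_mul]
    linarith

/-- Successive symmetrization of `v` along the rows (the fibres of `q` in `Z`), each extended by
one element of the list. -/
def symRows {ι : Type*} [DecidableEq ι] (ρ : Representation ℚ (Perm X) V) (q : X → ι)
    (Z : Finset X) (v : V) : List X → V
  | [] => v
  | y :: l => addBox ρ 1 {x ∈ Z | q x = q y} y (symRows ρ q Z v l)

lemma IsInvariantInner.le_symRows_inner {ι : Type*} [DecidableEq ι] (hB : IsInvariantInner ρ B)
    {C Z : Finset X}
    (hCZ : Disjoint C Z) {v : V} (hC : SwapEigen ρ (-1) C v)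
    (hG : ∀ x ∈ Z, ∑ y ∈ C, ρ (swap x y) v = v) (q : X → ι) (hq : Set.InjOn q C) :
    ∀ (l : List X) (k : List (X × X)), l.Nodup → (k.map Prod.snd).Nodup →
      (∀ a ∈ k, a.1 ∈ Z ∧ a.2 ∈ C ∧ q a.1 = q a.2) → (∀ y ∈ l, y ∈ C ∧ y ∉ k.map Prod.snd) →
      B (ρ (swapList k) v) v ≤ B (ρ (swapList k) (symRows ρ q Z v l)) v ∧
        0 ≤ B (ρ (swapList k) (symRows ρ q Z v l)) v
  | [], k, _, hk, hk', _ => by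
    have h1 : (k.map Prod.fst).Nodup := by
      have : (k.map (fun a => q a.1)).Nodup := by
        rw [List.map_congr_left (g := fun a => q a.2) fun a ha => (hk' a ha).2.2]
        rw [← Function.comp_def q Prod.snd, ← List.map_map]
        refine List.Nodup.map_on ?_ hk
        intro a ha b hb
        obtain ⟨a', ha', rfl⟩ := List.mem_map.mp ha
        obtain ⟨b', hb', rfl⟩ := List.mem_map.mp hb
        exact hq (hk' a' ha').2.1 (hk' b' hb').2.1
      exact List.Nodup.of_map q (by rwa [List.map_map])
    obtain ⟨c, hc, h⟩ := hB.swapList_inner hCZ hC hG k h1 hk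
      fun a ha => ⟨(hk' a ha).1, (hk' a ha).2.1⟩
    have h2 := hB.antisymList_inner_nonneg v _ h1
    rw [← h v hC] at h2
    exact ⟨le_rfl, nonneg_of_mul_nonneg_right h2 hc⟩
  | y :: l, k, hl, hk, hk', hlk => by
    rw [List.nodup_cons] at hl
    have ih := hB.le_symRows_inner hCZ hC hG q hq l k hl.2 hk hk'
      fun z hz => hlk z (List.mem_cons_of_mem _ hz)
    have hy := hlk y (by simp)
    have hterm : 0 ≤ ∑ x ∈ Z with q x = q y,
        B (ρ (swapList ((x, y) :: k)) (symRows ρ q Z v l)) v := by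
      refine Finset.sum_nonneg fun x hx => ?_
      rw [Finset.mem_filter] at hx
      refine (hB.le_symRows_inner hCZ hC hG q hq l _ hl.2 ?_ ?_ ?_).2
      · rw [List.map_cons, List.nodup_cons]; exact ⟨hy.2, hk⟩
      · intro a ha
        rcases List.mem_cons.mp ha with rfl | ha
        · exact ⟨hx.1, hy.1, hx.2⟩
        · exact hk' a ha
      · intro z hz
        refine ⟨(hlk z (List.mem_cons_of_mem _ hz)).1, ?_⟩
        rw [List.map_cons, List.mem_cons, not_or]
        exact ⟨fun e => hl.1 ((show z = y from e) ▸ hz), (hlk z (List.mem_cons_of_mem _ hz)).2⟩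
    have e : B (ρ (swapList k) (symRows ρ q Z v (y :: l))) v =
        B (ρ (swapList k) (symRows ρ q Z v l)) v + ∑ x ∈ Z with q x = q y,
          B (ρ (swapList ((x, y) :: k)) (symRows ρ q Z v l)) v := by
      simp only [symRows, addBox, one_smul, map_add, map_sum, LinearMap.add_apply,
        LinearMap.sum_apply, swapList, map_mul, Module.End.mul_apply, swap_comm y]
    rw [e]
    constructor <;> linarith [ih.1, ih.2]

lemma symRows_swapEigen_of_disjoint {ι : Type*} [DecidableEq ι] (q : X → ι) (Z : Finset X) {v : V}
    {s : ℚ} {T : Finset X} (hT : Disjoint T Z) (h : SwapEigen ρ s T v) :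
    ∀ l : List X, (∀ y ∈ l, y ∉ T) → SwapEigen ρ s T (symRows ρ q Z v l)
  | [], _ => h
  | y :: l, hl => by
    refine (symRows_swapEigen_of_disjoint q Z hT h l
      fun z hz => hl z (List.mem_cons_of_mem _ hz)).addBox_of_disjoint fun x hx => ?_
    exact ⟨fun e => hl y (by simp) (e ▸ hx), fun hx' => Finset.disjoint_left.mp hT hx
      (Finset.mem_filter.mp hx').1⟩

lemma symRows_swapEigen {ι : Type*} [DecidableEq ι] (q : X → ι) (Z : Finset X) {v : V}
    (h : ∀ i, SwapEigen ρ 1 {x ∈ Z | q x = i} v) :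
    ∀ l : List X, l.Nodup → (∀ y ∈ l, y ∉ Z) → Set.InjOn q {y | y ∈ l} → ∀ i,
      SwapEigen ρ 1 {x ∈ l.toFinset ∪ Z | q x = i} (symRows ρ q Z v l)
  | [], _, _, _, i => by simpa [symRows] using h i
  | y :: l, hl, hlZ, hq, i => by
    rw [List.nodup_cons] at hl
    have ih := symRows_swapEigen q Z h l hl.2 (fun z hz => hlZ z (List.mem_cons_of_mem _ hz))
      (hq.mono fun z hz => List.mem_cons_of_mem _ hz)
    have hne : ∀ z ∈ l, q z ≠ q y := fun z hz e =>
      hl.1 (hq (show z ∈ y :: l from List.mem_cons_of_mem _ hz) (by simp) e ▸ hz)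
    rw [symRows]
    rcases eq_or_ne i (q y) with rfl | hi
    · have e : ({x ∈ (y :: l).toFinset ∪ Z | q x = q y} : Finset X) =
          insert y {x ∈ Z | q x = q y} := by
        ext z
        simp only [List.toFinset_cons, Finset.mem_filter, Finset.mem_union, Finset.mem_insert,
          List.mem_toFinset]
        constructor
        · rintro ⟨(rfl | hz) | hz, hqz⟩
          · exact Or.inl rfl
          · exact absurd hqz (hne z hz)
          · exact Or.inr ⟨hz, hqz⟩
        · rintro (rfl | hz)
          · simp
          · exact ⟨Or.inr hz.1, hz.2⟩
      rw [e]
      refine ((ih (q y)).mono fun z hz => ?_).addBox_insert (by norm_num) ?_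
      · rw [Finset.mem_filter] at hz ⊢
        exact ⟨Finset.mem_union_right _ hz.1, hz.2⟩
      · simp [hlZ y (by simp)]
    · refine ((ih i).mono fun z hz => ?_).addBox_of_disjoint fun z hz => ?_
      · simp only [List.toFinset_cons, Finset.mem_filter, Finset.mem_union, Finset.mem_insert,
          List.mem_toFinset] at hz ⊢
        rcases hz with ⟨(rfl | hz) | hz, hqz⟩
        · exact absurd hqz.symm hi
        · exact ⟨Or.inl hz, hqz⟩
        · exact ⟨Or.inr hz, hqz⟩
      · rw [Finset.mem_filter] at hz
        refine ⟨fun e => hi (e ▸ hz.2).symm, fun h => hi ?_⟩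
        rw [← hz.2, (Finset.mem_filter.mp h).2]

end RowSymmetrization

section Coloring

open Equiv

variable {X V : Type*} [DecidableEq X] [Fintype X] [AddCommGroup V] [Module ℚ V]
  {ρ : Representation ℚ (Perm X) V} {B : V →ₗ[ℚ] V →ₗ[ℚ] ℚ}

/-- The set of elements of colour `c`. -/
def colorClass (p : X → ℕ) (c : ℕ) : Finset X := {x | p x = c}

omit [DecidableEq X] in
lemma mem_colorClass {p : X → ℕ} {c : ℕ} {x : X} : x ∈ colorClass p c ↔ p x = c := by
  simp [colorClass]

/-- `M` contains a nonzero vector with eigenvalue `s` under all transpositions within the colour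
classes of `p`. -/
def HasEigen (ρ : Representation ℚ (Perm X) V) (M : Submodule ℚ V) (s : ℚ) (p : X → ℕ) : Prop :=
  ∃ v ∈ M, v ≠ 0 ∧ ∀ c, SwapEigen ρ s (colorClass p c) v

omit [Fintype X] in
lemma addBox_mem {M : Submodule ℚ V} (hM : ∀ g, ∀ v ∈ M, ρ g v ∈ M) (s : ℚ) (S : Finset X) (z : X)
    {v : V} (hv : v ∈ M) : addBox ρ s S z v ∈ M :=
  M.add_mem hv (M.smul_mem _ (M.sum_mem fun _ _ => hM _ _ hv))

omit [Fintype X] in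
lemma symRows_mem {M : Submodule ℚ V} (hM : ∀ g, ∀ v ∈ M, ρ g v ∈ M) {ι : Type*} [DecidableEq ι]
    (q : X → ι) (Z : Finset X) {v : V} (hv : v ∈ M) : ∀ l : List X, symRows ρ q Z v l ∈ M
  | [] => hv
  | _ :: l => addBox_mem hM _ _ _ (symRows_mem hM q Z hv l)

lemma colorClass_update (p : X → ℕ) (z : X) (c : ℕ) :
    colorClass (Function.update p z c) c = insert z (colorClass p c) := by
  ext x
  rw [mem_colorClass, Finset.mem_insert, mem_colorClass, Function.update_apply]
  split_ifs with h <;> simp [h]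

lemma colorClass_update_of_ne (p : X → ℕ) (z : X) {c c' : ℕ} (h : c' ≠ c) :
    colorClass (Function.update p z c) c' = (colorClass p c').erase z := by
  ext x
  rw [mem_colorClass, Finset.mem_erase, mem_colorClass, Function.update_apply]
  split_ifs with h' <;> simp [h', h.symm]

lemma HasEigen.exists_update (hB : IsInvariantInner ρ B) {M : Submodule ℚ V}
    (hM : ∀ g, ∀ v ∈ M, ρ g v ∈ M) {p : X → ℕ} (h : HasEigen ρ M (-1) p) {b a : ℕ} (hab : a ≠ b)
    (hlt : (colorClass p a).card < (colorClass p b).card) :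
    ∃ z, p z = b ∧ HasEigen ρ M (-1) (Function.update p z a) := by
  obtain ⟨v, hvM, hv, hp⟩ := h
  have hdisj : Disjoint (colorClass p b) (colorClass p a) :=
    Finset.disjoint_left.mpr fun x hx hx' =>
      hab ((mem_colorClass.mp hx').symm.trans (mem_colorClass.mp hx))
  obtain ⟨z, hz, hne⟩ := exists_addBox_ne_zero hB hdisj hlt hv (hp b)
  refine ⟨z, mem_colorClass.mp hz, _, addBox_mem hM _ _ _ hvM, hne, fun c => ?_⟩
  rcases eq_or_ne c a with rfl | hc
  · rw [colorClass_update]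
    exact (hp c).addBox_insert (by norm_num) (Finset.disjoint_left.mp hdisj hz)
  · rw [colorClass_update_of_ne _ _ hc]
    refine ((hp c).mono (Finset.erase_subset _ _)).addBox_of_disjoint fun x hx => ?_
    rw [Finset.mem_erase, mem_colorClass] at hx
    exact ⟨hx.1, fun h => hc (hx.2.symm.trans (mem_colorClass.mp h))⟩

/-- A numerical encoding of the lexicographic order on the sequences of class sizes. -/
def lexWeight (p : X → ℕ) : ℕ := ∑ x, (Fintype.card X + 1) ^ (Fintype.card X - p x)

lemma exists_maximal_hasEigen {M : Submodule ℚ V} (hM : M ≠ ⊥) :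
    ∃ p : X → ℕ, HasEigen ρ M (-1) p ∧
      ∀ p', HasEigen ρ M (-1) p' → lexWeight p' ≤ lexWeight p := by
  set K := Fintype.card X * (Fintype.card X + 1) ^ Fintype.card X
  have hK : ∀ p : X → ℕ, lexWeight p ≤ K := fun p =>
    (Finset.sum_le_card_nsmul _ _ _ fun x _ => Nat.pow_le_pow_right (Nat.succ_pos _)
      (Nat.sub_le _ _)).trans (by simp [K])
  obtain ⟨v, hvM, hv⟩ := M.ne_bot_iff.mp hM
  have hne : HasEigen ρ M (-1) (fun x => (Fintype.equivFin X x : ℕ)) := by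
    refine ⟨v, hvM, hv, fun c => SwapEigen.of_card_le_one (Finset.card_le_one.mpr ?_)⟩
    intro x hx y hy
    rw [mem_colorClass] at hx hy
    exact (Fintype.equivFin X).injective (Fin.ext (hx.trans hy.symm))
  obtain ⟨p, hp, hmin⟩ := (measure fun p : X → ℕ => K - lexWeight p).wf.has_min
    {p | HasEigen ρ M (-1) p} ⟨_, hne⟩
  refine ⟨p, hp, fun p' hp' => ?_⟩
  have h1 := hmin p' hp'
  have h2 := hK p
  have h3 := hK p'
  simp only [WellFoundedRelation.rel, InvImage] at h1
  omega

lemma lexWeight_lt_update {p : X → ℕ} {z : X} {c : ℕ} (hc : c < p z) (hcX : c < Fintype.card X) :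
    lexWeight p < lexWeight (Function.update p z c) := by
  refine Finset.sum_lt_sum (fun x _ => ?_) ⟨z, Finset.mem_univ _, ?_⟩
  · rw [Function.update_apply]
    split_ifs with h
    · subst h; exact Nat.pow_le_pow_right (Nat.succ_pos _) (by omega)
    · exact le_rfl
  · rw [Function.update_self]
    have : 0 < Fintype.card X := Fintype.card_pos_iff.mpr ⟨z⟩
    exact Nat.pow_lt_pow_right (by omega) (by omega)

lemma lt_card_of_maximal {M : Submodule ℚ V} {p : X → ℕ} (hp : HasEigen ρ M (-1) p)
    (hmax : ∀ p', HasEigen ρ M (-1) p' → lexWeight p' ≤ lexWeight p) (x : X) :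
    p x < Fintype.card X := by
  by_contra! hx
  obtain ⟨c, hc, hcp⟩ : ∃ c ∈ Finset.range (Fintype.card X), c ∉ (Finset.univ.erase x).image p := by
    by_contra! hcon
    have := Finset.card_le_card hcon
    have h2 : ((Finset.univ.erase x).image p).card ≤ _ := Finset.card_image_le
    rw [Finset.card_range] at this
    rw [Finset.card_erase_of_mem (Finset.mem_univ _), Finset.card_univ] at h2
    have : 0 < Fintype.card X := Fintype.card_pos_iff.mpr ⟨x⟩
    omega
  rw [Finset.mem_range] at hc
  refine (lexWeight_lt_update (p := p) (z := x) (hc.trans_le hx) hc).not_ge (hmax _ ?_)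
  obtain ⟨v, hvM, hv, h⟩ := hp
  refine ⟨v, hvM, hv, fun c' => ?_⟩
  rcases eq_or_ne c' c with rfl | hne
  · rw [colorClass_update]
    refine SwapEigen.of_card_le_one (Finset.card_le_one.mpr ?_)
    have : ∀ y ∈ insert x (colorClass p c'), y = x := by
      intro y hy
      rw [Finset.mem_insert, mem_colorClass] at hy
      rcases hy with hy | hy
      · exact hy
      · by_contra hyx
        exact hcp (Finset.mem_image.mpr ⟨y, by simp [hyx], hy⟩)
    intro y hy z hz
    rw [this y hy, this z hz]
  · rw [colorClass_update_of_ne _ _ hne]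
    exact (h c').mono (Finset.erase_subset _ _)

lemma card_antitone_of_maximal (hB : IsInvariantInner ρ B) {M : Submodule ℚ V}
    (hM : ∀ g, ∀ v ∈ M, ρ g v ∈ M) {p : X → ℕ} (hp : HasEigen ρ M (-1) p)
    (hmax : ∀ p', HasEigen ρ M (-1) p' → lexWeight p' ≤ lexWeight p) :
    Antitone fun c => (colorClass p c).card := by
  intro a b hab
  by_contra! hlt
  have hne : a ≠ b := by rintro rfl; exact lt_irrefl _ hlt
  obtain ⟨z, hz, hz'⟩ := hp.exists_update hB hM hne hlt
  have := lt_card_of_maximal hp hmax z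
  exact (lexWeight_lt_update (p := p) (z := z) (c := a) (by omega) (by omega)).not_ge (hmax _ hz')

/-- The Garnir relations: a vector which is alternating in the first columns of the
lexicographically largest shape is killed by moving a further box into these columns. -/
lemma garnir_of_maximal {M : Submodule ℚ V}
    (hM : ∀ g, ∀ v ∈ M, ρ g v ∈ M) {p : X → ℕ}
    (hmax : ∀ p', HasEigen ρ M (-1) p' → lexWeight p' ≤ lexWeight p) {t : ℕ}
    (ht : t < Fintype.card X) {v : V} (hvM : v ∈ M)
    (hv : ∀ c ≤ t, SwapEigen ρ (-1) (colorClass p c) v) {x : X} (hx : t < p x) :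
    ∑ y ∈ colorClass p t, ρ (swap x y) v = v := by
  by_contra hne
  set p' : X → ℕ := fun y => if p y ≤ t then p y else if y = x then t else
    t + 1 + Fintype.equivFin X y with hp'
  have hlt : lexWeight p < lexWeight p' := by
    unfold lexWeight
    rw [← Finset.sum_filter_add_sum_filter_not _ (fun y => p y ≤ t),
      ← Finset.sum_filter_add_sum_filter_not (s := Finset.univ) (fun y => p y ≤ t)
        (fun y => (Fintype.card X + 1) ^ (Fintype.card X - p' y))]
    refine add_lt_add_of_le_of_lt (Finset.sum_le_sum fun y hy => ?_) ?_
    · simp [hp', (Finset.mem_filter.mp hy).2]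
    · calc _ ≤ _ := Finset.sum_le_card_nsmul _ _
            ((Fintype.card X + 1) ^ (Fintype.card X - t - 1)) fun y hy => by
              have := (Finset.mem_filter.mp hy).2
              exact Nat.pow_le_pow_right (Nat.succ_pos _) (by omega)
        _ ≤ Fintype.card X * (Fintype.card X + 1) ^ (Fintype.card X - t - 1) := by
              rw [smul_eq_mul]
              exact Nat.mul_le_mul_right _ (Finset.card_le_univ _)
        _ < (Fintype.card X + 1) * (Fintype.card X + 1) ^ (Fintype.card X - t - 1) := by
              exact Nat.mul_lt_mul_of_pos_right (Nat.lt_succ_self _) (by positivity)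
        _ = (Fintype.card X + 1) ^ (Fintype.card X - p' x) := by
              have : p' x = t := by simp [hp', hx.not_ge]
              rw [← pow_succ', this]
              congr 1; omega
        _ ≤ _ := Finset.single_le_sum
              (f := fun y => (Fintype.card X + 1) ^ (Fintype.card X - p' y))
              (fun _ _ => Nat.zero_le _) (by simp [hx])
  refine hlt.not_ge (hmax p' ⟨addBox ρ (-1) (colorClass p t) x v, addBox_mem hM _ _ _ hvM, ?_, ?_⟩)
  · intro h
    rw [addBox, neg_one_smul, ← sub_eq_add_neg, sub_eq_zero] at h
    exact hne h.symm
  · intro c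
    have hxt : x ∉ colorClass p t := fun h => hx.ne' (mem_colorClass.mp h)
    rcases lt_trichotomy c t with hc | rfl | hc
    · have : colorClass p' c = colorClass p c := by
        ext y
        simp only [mem_colorClass, hp']
        split_ifs <;> omega
      rw [this]
      refine (hv c hc.le).addBox_of_disjoint fun y hy => ?_
      rw [mem_colorClass] at hy
      refine ⟨?_, fun h => hc.ne (hy.symm.trans (mem_colorClass.mp h))⟩
      rintro rfl; omega
    · have : colorClass p' c = insert x (colorClass p c) := by
        ext y
        simp only [mem_colorClass, hp', Finset.mem_insert]
        split_ifs with h1 h2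
        · have : y ≠ x := by rintro rfl; omega
          simp [this]
        · simp [h2]
        · simp only [h2, false_or]; omega
      rw [this]
      exact (hv c le_rfl).addBox_insert (by norm_num) hxt
    · refine SwapEigen.of_card_le_one (Finset.card_le_one.mpr ?_)
      have : ∀ y ∈ colorClass p' c, t + 1 + (Fintype.equivFin X y : ℕ) = c := by
        intro y hy
        simp only [mem_colorClass, hp'] at hy
        split_ifs at hy <;> omega
      intro y hy z hz
      refine (Fintype.equivFin X).injective (Fin.ext ?_)
      have h1 := this y hy
      have h2 := this z hz
      omega

omit [DecidableEq X] in
lemma exists_rows (p : X → ℕ) : ∃ q : X → ℕ, (∀ c, Set.InjOn q (colorClass p c)) ∧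
    ∀ x, q x < (colorClass p (p x)).card := by
  refine ⟨fun x => (colorClass p (p x)).equivFin ⟨x, mem_colorClass.mpr rfl⟩, ?_, ?_⟩
  · intro c x hx y hy hxy
    obtain rfl := mem_colorClass.mp hx
    have hy' : p y = p x := mem_colorClass.mp hy
    have key : ∀ (c : ℕ) (hc : p y = c), ((colorClass p (p y)).equivFin
        ⟨y, mem_colorClass.mpr rfl⟩ : ℕ) = (colorClass p c).equivFin ⟨y, mem_colorClass.mpr hc⟩ := by
      rintro c rfl; rfl
    simp only [key _ hy'] at hxy
    simpa using (colorClass p (p x)).equivFin.injective (Fin.ext hxy)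
  · intro x
    exact Fin.is_lt _

/-- A nonzero representation of the symmetric group has, for some shape, both a nonzero vector
alternating along the columns and a nonzero vector symmetric along the rows. -/
theorem exists_columns_rows (hB : IsInvariantInner ρ B) {M : Submodule ℚ V} (hM0 : M ≠ ⊥)
    (hM : ∀ g, ∀ v ∈ M, ρ g v ∈ M) :
    ∃ p q : X → ℕ, HasEigen ρ M (-1) p ∧ HasEigen ρ M 1 q ∧
      (Antitone fun c => (colorClass p c).card) ∧ (∀ c, Set.InjOn q (colorClass p c)) ∧
      ∀ x, q x < (colorClass p (p x)).card := by
  obtain ⟨p, hp, hmax⟩ := exists_maximal_hasEigen (ρ := ρ) hM0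
  obtain ⟨q, hq, hq'⟩ := exists_rows p
  refine ⟨p, q, hp, ?_, card_antitone_of_maximal hB hM hp hmax, hq, hq'⟩
  have hpX := lt_card_of_maximal hp hmax
  have main : ∀ k t : ℕ, t + k = Fintype.card X → ∃ v ∈ M, v ≠ 0 ∧
      (∀ c < t, SwapEigen ρ (-1) (colorClass p c) v) ∧
      ∀ i, SwapEigen ρ 1 {x ∈ ({x | t ≤ p x} : Finset X) | q x = i} v := by
    intro k
    induction k with
    | zero =>
      intro t ht
      obtain ⟨v, hvM, hv, h⟩ := hp
      refine ⟨v, hvM, hv, fun c _ => h c, fun i x hx => ?_⟩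
      have := hpX x
      simp only [Finset.mem_filter, Finset.mem_univ, true_and] at hx
      omega
    | succ k ih =>
      intro t ht
      obtain ⟨v, hvM, hv, hcol, hrow⟩ := ih (t + 1) (by omega)
      set Z : Finset X := {x | t + 1 ≤ p x} with hZ
      have hCZ : Disjoint (colorClass p t) Z := by
        refine Finset.disjoint_left.mpr fun x hx hx' => ?_
        rw [mem_colorClass] at hx
        simp only [hZ, Finset.mem_filter, Finset.mem_univ, true_and] at hx'
        omega
      have hG : ∀ x ∈ Z, ∑ y ∈ colorClass p t, ρ (swap x y) v = v := fun x hx =>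
        garnir_of_maximal hM hmax (by omega) hvM (fun c hc => hcol c (by omega))
          (by simpa [hZ] using hx)
      have hlist : ∀ y ∈ (colorClass p t).toList, y ∈ colorClass p t := fun y => Finset.mem_toList.mp
      refine ⟨symRows ρ q Z v (colorClass p t).toList, symRows_mem hM q Z hvM _, ?_, ?_, ?_⟩
      · intro h0
        have := (hB.le_symRows_inner hCZ (hcol t (by omega)) hG q (hq t) (colorClass p t).toList []
          (Finset.nodup_toList _) (by simp) (by simp) (by simp)).1
        rw [h0] at this
        simp only [swapList, map_one, Module.End.one_apply, map_zero, LinearMap.zero_apply] at this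
        exact this.not_gt (hB.pos v hv)
      · intro c hc
        refine symRows_swapEigen_of_disjoint q Z ?_ (hcol c (by omega)) _ fun y hy hy' => ?_
        · refine Finset.disjoint_left.mpr fun x hx hx' => ?_
          rw [mem_colorClass] at hx
          simp only [hZ, Finset.mem_filter, Finset.mem_univ, true_and] at hx'
          omega
        · have := mem_colorClass.mp (hlist y hy)
          have := mem_colorClass.mp hy'
          omega
      · intro i
        have := symRows_swapEigen q Z hrow (colorClass p t).toList (Finset.nodup_toList _)
          (fun y hy => Finset.disjoint_left.mp hCZ (hlist y hy))
          ((hq t).mono fun y hy => hlist y hy) i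
        refine this.mono fun x hx => ?_
        simp only [Finset.toList_toFinset, Finset.mem_filter, Finset.mem_union, mem_colorClass, hZ,
          Finset.mem_univ, true_and] at hx ⊢
        exact ⟨by omega, hx.2⟩
  obtain ⟨v, hvM, hv, -, hrow⟩ := main (Fintype.card X) 0 (by simp)
  refine ⟨v, hvM, hv, fun i => (hrow i).mono fun x hx => ?_⟩
  simpa using mem_colorClass.mp hx

end Coloring

section YoungOrder

lemma youngGamma_cons (s : ℕ) (σ : Multiset ℕ) (j : ℕ) :
    youngGamma (s ::ₘ σ) j = (s + 1 - j) + youngGamma σ j := by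
  simp [youngGamma]

lemma count_add_two_mul_youngGamma (σ : Multiset ℕ) (b : ℕ) :
    σ.count b + 2 * youngGamma σ (b + 1) = youngGamma σ b + youngGamma σ (b + 2) := by
  induction σ using Multiset.induction_on with
  | empty => simp [youngGamma]
  | cons s σ ih =>
    rw [Multiset.count_cons]
    simp only [youngGamma_cons]
    split_ifs <;> omega

lemma le_youngGamma_one_of_mem {σ : Multiset ℕ} {s : ℕ} (hs : s ∈ σ) : s ≤ youngGamma σ 1 := by
  obtain ⟨τ, rfl⟩ := Multiset.exists_cons_of_mem hs
  rw [youngGamma_cons]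
  omega

lemma youngGamma_eq_zero {σ : Multiset ℕ} {j : ℕ} (hj : youngGamma σ 1 < j) :
    youngGamma σ j = 0 := by
  refine Multiset.sum_eq_zero fun x hx => ?_
  obtain ⟨s, hs, rfl⟩ := Multiset.mem_map.mp hx
  have := le_youngGamma_one_of_mem hs
  omega

lemma IsYoungDiagram.eq_of_youngGamma_eq {σ τ : Multiset ℕ} (hσ : IsYoungDiagram σ)
    (hτ : IsYoungDiagram τ) (h : ∀ j, 1 ≤ j → youngGamma σ j = youngGamma τ j) : σ = τ := by
  ext b
  rcases Nat.eq_zero_or_pos b with rfl | hb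
  · rw [Multiset.count_eq_zero.mpr fun h0 => (hσ 0 h0).ne rfl,
      Multiset.count_eq_zero.mpr fun h0 => (hτ 0 h0).ne rfl]
  · have h1 := count_add_two_mul_youngGamma σ b
    have h2 := count_add_two_mul_youngGamma τ b
    rw [h b hb, h (b + 1) (by omega), h (b + 2) (by omega)] at h1
    omega

/-- If `σ < τ` are Young diagrams of the same size, then moving a box of `τ` from a part `b` to
a part `a` (possibly empty) gives a Young diagram between `σ` and `τ`. -/
lemma exists_parts_of_youngLE {σ τ : Multiset ℕ} (hσ : IsYoungDiagram σ) (hτ : IsYoungDiagram τ)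
    (hle : YoungLE σ τ) (h1 : youngGamma σ 1 = youngGamma τ 1) (hne : σ ≠ τ) :
    ∃ a b, b ∈ τ ∧ (1 ≤ a → a ∈ τ) ∧ a + 2 ≤ b ∧
      ∀ j, a + 1 < j → j ≤ b → youngGamma σ j < youngGamma τ j := by
  obtain ⟨j₀, hj₀, hjne⟩ : ∃ j, 1 ≤ j ∧ youngGamma σ j < youngGamma τ j := by
    by_contra! hcon
    exact hne (hσ.eq_of_youngGamma_eq hτ fun j hj => le_antisymm (hle j hj) (hcon j hj))
  have hbound : ∀ j, youngGamma σ j < youngGamma τ j → j ≤ youngGamma τ 1 := fun j hj => by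
    by_contra! hcon
    rw [youngGamma_eq_zero hcon] at hj
    omega
  set b := Nat.findGreatest (fun j => youngGamma σ j < youngGamma τ j) (youngGamma τ 1) with hb
  have hbspec : youngGamma σ b < youngGamma τ b :=
    Nat.findGreatest_spec (P := fun j => youngGamma σ j < youngGamma τ j) (hbound _ hjne) hjne
  have hj₀b : j₀ ≤ b := Nat.le_findGreatest (hbound _ hjne) hjne
  have hbmax : ∀ j, b < j → youngGamma σ j = youngGamma τ j := fun j hj => by
    refine le_antisymm (hle j (by omega)) ?_
    by_contra! hcon
    exact hj.not_ge (Nat.le_findGreatest (hbound _ hcon) hcon)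
  have hb2 : 2 ≤ b := by
    by_contra! hcon
    have : b = 1 := by omega
    rw [this] at hbspec
    omega
  set k := Nat.findGreatest (fun j => 1 ≤ j ∧ youngGamma σ j = youngGamma τ j) (b - 1) with hk
  have hkspec : 1 ≤ k ∧ youngGamma σ k = youngGamma τ k :=
    Nat.findGreatest_spec (P := fun j => 1 ≤ j ∧ youngGamma σ j = youngGamma τ j)
      (m := 1) (by omega) ⟨le_rfl, h1⟩
  have hkb : k ≤ b - 1 := Nat.findGreatest_le _
  have hmid : ∀ j, k < j → j ≤ b → youngGamma σ j < youngGamma τ j := fun j hkj hjb => by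
    rcases hjb.eq_or_lt with rfl | hjb
    · exact hbspec
    refine lt_of_le_of_ne (hle j (by omega)) fun he => ?_
    exact hkj.not_ge (Nat.le_findGreatest (by omega) ⟨by omega, he⟩)
  refine ⟨k - 1, b, ?_, fun ha => ?_, by omega, fun j hj hjb => hmid j (by omega) hjb⟩
  · have e1 := count_add_two_mul_youngGamma σ b
    have e2 := count_add_two_mul_youngGamma τ b
    have e3 := hbmax (b + 1) (by omega)
    have e4 := hbmax (b + 2) (by omega)
    exact Multiset.count_pos.mp (by omega)
  · clear_value k
    obtain ⟨a, rfl⟩ : ∃ a, k = a + 1 := ⟨k - 1, by omega⟩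
    have e1 := count_add_two_mul_youngGamma σ a
    have e2 := count_add_two_mul_youngGamma τ a
    have e3 := hle a (by omega)
    have e4 := hmid (a + 2) (by omega) (by omega)
    rw [Nat.add_sub_cancel]
    exact Multiset.count_pos.mp (by omega)

end YoungOrder

section ColoringShape

open Equiv

variable {X V : Type*} [Fintype X]

/-- The Young diagram formed by the sizes of the nonempty colour classes. -/
def shape (p : X → ℕ) : Multiset ℕ :=
  (Finset.univ.image p).val.map fun c => (colorClass p c).card

lemma isYoungDiagram_shape (p : X → ℕ) : IsYoungDiagram (shape p) := by
  intro s hs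
  obtain ⟨c, hc, rfl⟩ := Multiset.mem_map.mp hs
  obtain ⟨x, -, rfl⟩ := Finset.mem_image.mp hc
  exact Finset.card_pos.mpr ⟨x, mem_colorClass.mpr rfl⟩

lemma youngGamma_shape (p : X → ℕ) {T : Finset ℕ} (hT : ∀ x, p x ∈ T) {j : ℕ} (hj : 1 ≤ j) :
    youngGamma (shape p) j = ∑ c ∈ T, ((colorClass p c).card + 1 - j) := by
  rw [youngGamma, shape, Multiset.map_map]
  refine Finset.sum_subset (fun c hc => ?_) fun c _ hc => ?_
  · obtain ⟨x, -, rfl⟩ := Finset.mem_image.mp hc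
    exact hT x
  · have : colorClass p c = ∅ := Finset.eq_empty_of_forall_notMem fun x hx =>
      hc (Finset.mem_image.mpr ⟨x, Finset.mem_univ _, mem_colorClass.mp hx⟩)
    simp only [Function.comp_apply, this, Finset.card_empty]
    omega

lemma youngGamma_shape_one (p : X → ℕ) : youngGamma (shape p) 1 = Fintype.card X := by
  rw [youngGamma_shape p (fun x => Finset.mem_image_of_mem p (Finset.mem_univ x)) le_rfl]
  simp only [Nat.add_sub_cancel]
  exact (Finset.card_eq_sum_card_image p Finset.univ).symm

variable [DecidableEq X] [AddCommGroup V] [Module ℚ V]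
  {ρ : Representation ℚ (Perm X) V} {B : V →ₗ[ℚ] V →ₗ[ℚ] ℚ}

lemma youngGamma_shape_update (p : X → ℕ) {z : X} {a j : ℕ} (ha : a ≠ p z) (hj : 1 ≤ j) :
    youngGamma (shape (Function.update p z a)) j + ((colorClass p (p z)).card + 1 - j) +
        ((colorClass p a).card + 1 - j) =
      youngGamma (shape p) j + ((colorClass p (p z)).card - j) +
        ((colorClass p a).card + 2 - j) := by
  set T : Finset ℕ := insert a (Finset.univ.image p) with hT
  have hpT : ∀ x, p x ∈ T := fun x => by simp [hT]
  have huT : ∀ x, Function.update p z a x ∈ T := fun x => by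
    rw [Function.update_apply]
    split_ifs
    · simp [hT]
    · exact hpT x
  have hz : z ∈ colorClass p (p z) := mem_colorClass.mpr rfl
  have hpz : p z ∈ T.erase a := Finset.mem_erase.mpr ⟨ha.symm, hpT z⟩
  have haT : a ∈ T := Finset.mem_insert_self _ _
  rw [youngGamma_shape _ hpT hj, youngGamma_shape _ huT hj, ← Finset.add_sum_erase _ _ haT,
    ← Finset.add_sum_erase _ _ hpz, ← Finset.add_sum_erase (a := a) T _ haT,
    ← Finset.add_sum_erase (a := p z) (T.erase a) _ hpz, colorClass_update,
    colorClass_update_of_ne _ _ ha.symm,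
    Finset.card_insert_of_notMem fun h => ha (mem_colorClass.mp h).symm, Finset.card_erase_of_mem hz]
  have : ∑ c ∈ (T.erase a).erase (p z),
      ((colorClass (Function.update p z a) c).card + 1 - j) =
      ∑ c ∈ (T.erase a).erase (p z), ((colorClass p c).card + 1 - j) := by
    refine Finset.sum_congr rfl fun c hc => ?_
    simp only [Finset.mem_erase] at hc
    rw [colorClass_update_of_ne _ _ hc.2.1, Finset.erase_eq_of_notMem]
    exact fun h => hc.1 (mem_colorClass.mp h).symm
  rw [this]
  have := Finset.card_pos.mpr ⟨z, hz⟩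
  omega

/-- The shapes of colourings with a nonzero alternating vector form a down-closed set. -/
theorem HasEigen.exists_shape_eq (hB : IsInvariantInner ρ B) {M : Submodule ℚ V}
    (hM : ∀ g, ∀ v ∈ M, ρ g v ∈ M) {σ : Multiset ℕ} (hσ : IsYoungDiagram σ)
    (h1 : youngGamma σ 1 = Fintype.card X) {p : X → ℕ} (hp : HasEigen ρ M (-1) p)
    (hle : YoungLE σ (shape p)) : ∃ p' : X → ℕ, shape p' = σ ∧ HasEigen ρ M (-1) p' := by
  induction hN : ∑ j ∈ Finset.Icc 1 (Fintype.card X), youngGamma (shape p) j using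
    Nat.strong_induction_on generalizing p with
  | _ N ih =>
    by_cases hne : σ = shape p
    · exact ⟨p, hne.symm, hp⟩
    obtain ⟨a, b, hb, ha, hab, hlt⟩ := exists_parts_of_youngLE hσ (isYoungDiagram_shape p) hle
      (h1.trans (youngGamma_shape_one p).symm) hne
    obtain ⟨cb, -, hcb⟩ := Multiset.mem_map.mp hb
    obtain ⟨ca, hca⟩ : ∃ ca, (colorClass p ca).card = a := by
      rcases Nat.eq_zero_or_pos a with rfl | ha0
      · obtain ⟨c, hc⟩ := Infinite.exists_notMem_finset (Finset.univ.image p)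
        refine ⟨c, Finset.card_eq_zero.mpr (Finset.eq_empty_of_forall_notMem fun x hx => hc ?_)⟩
        exact Finset.mem_image.mpr ⟨x, Finset.mem_univ _, mem_colorClass.mp hx⟩
      · obtain ⟨c, -, hc⟩ := Multiset.mem_map.mp (ha ha0)
        exact ⟨c, hc⟩
    have hne' : ca ≠ cb := by rintro rfl; omega
    obtain ⟨z, rfl, hz⟩ := hp.exists_update hB hM hne' (by omega)
    have key := fun j (hj : 1 ≤ j) => youngGamma_shape_update p hne' hj
    rw [hca, hcb] at key
    have hbX : b ≤ Fintype.card X := hcb ▸ Finset.card_le_univ _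
    refine ih _ ?_ hz (fun j hj => ?_) rfl
    · rw [← hN]
      refine Finset.sum_lt_sum (fun j hj => ?_) ⟨b, Finset.mem_Icc.mpr ⟨by omega, hbX⟩, ?_⟩
      · have := key j (Finset.mem_Icc.mp hj).1
        omega
      · have := key b (by omega)
        omega
    · have h2 := key j hj
      have h3 := hle j hj
      by_cases h4 : a + 1 < j ∧ j ≤ b
      · have := hlt j h4.1 h4.2
        omega
      · omega

end ColoringShape

section Shapes

lemma youngGamma_filter_pos (σ : Multiset ℕ) {j : ℕ} (hj : 1 ≤ j) :
    youngGamma (σ.filter (0 < ·)) j = youngGamma σ j := by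
  induction σ using Multiset.induction_on with
  | empty => rfl
  | cons s σ ih =>
    rw [Multiset.filter_cons, youngGamma_cons, ← ih]
    split_ifs with h
    · rw [Multiset.singleton_add, youngGamma_cons]
    · rw [zero_add]
      omega

lemma isYoungDiagram_monomialShape {k : ℕ} (e : Fin k →₀ ℕ) : IsYoungDiagram (monomialShape e) :=
  fun _ hs => (Multiset.mem_filter.mp hs).2

lemma youngGamma_monomialShape_one {k : ℕ} (e : Fin k →₀ ℕ) :
    youngGamma (monomialShape e) 1 = e.sum fun _ v => v := by
  rw [monomialShape, youngGamma_filter_pos _ le_rfl, youngGamma, Multiset.map_map]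
  simp only [Function.comp_def, Nat.add_sub_cancel]
  change ∑ i ∈ Finset.range _, _ = _
  simp only [Finset.card_filter]
  rw [Finset.sum_comm, Finsupp.sum_fintype _ _ fun _ => rfl]
  refine Finset.sum_congr rfl fun j _ => ?_
  rw [← Finset.card_filter]
  have hj : e j ≤ ∑ i, e i := Finset.single_le_sum (fun _ _ => Nat.zero_le _) (Finset.mem_univ j)
  have : {i ∈ Finset.range (∑ i, e i) | i + 1 ≤ e j} = Finset.range (e j) := by
    ext i
    simp only [Finset.mem_filter, Finset.mem_range]
    omega
  rw [this, Finset.card_range]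

lemma exists_minimalShapes_youngLE {n m d r : ℕ} {τ : Multiset ℕ}
    (hτ : τ ∈ shapesOfSymPowMinors n m d r) : ∃ σ ∈ minimalShapes n m d r, YoungLE σ τ := by
  obtain ⟨σ, ⟨hσ, hστ⟩, hmin⟩ := (measure fun σ : Multiset ℕ =>
    ∑ j ∈ Finset.Icc 1 (youngGamma τ 1), youngGamma σ j).wf.has_min
    {σ | σ ∈ shapesOfSymPowMinors n m d r ∧ YoungLE σ τ} ⟨τ, hτ, fun _ _ => le_rfl⟩
  refine ⟨σ, ⟨hσ, fun υ hυ hυσ => ?_⟩, hστ⟩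
  have hle := hmin υ ⟨hυ, fun j hj => (hυσ j hj).trans (hστ j hj)⟩
  simp only [WellFoundedRelation.rel, InvImage, not_lt] at hle
  obtain ⟨e, -, rfl⟩ := hσ
  obtain ⟨e', -, rfl⟩ := hυ
  have heq := (Finset.sum_eq_sum_iff_of_le fun j hj => hυσ j (Finset.mem_Icc.mp hj).1).mp
    (le_antisymm (Finset.sum_le_sum fun j hj => hυσ j (Finset.mem_Icc.mp hj).1) hle)
  refine (isYoungDiagram_monomialShape _).eq_of_youngGamma_eq (isYoungDiagram_monomialShape _)
    fun j hj => ?_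
  by_cases hjτ : j ≤ youngGamma τ 1
  · exact heq j (Finset.mem_Icc.mpr ⟨hj, hjτ⟩)
  · have h1 := hστ 1 le_rfl
    have h2 := hυσ 1 le_rfl
    rw [youngGamma_eq_zero (by omega), youngGamma_eq_zero (by omega)]

lemma map_symPowMatrix {R S : Type*} [CommRing R] [CommRing S] (f : R →+* S) {m n : ℕ} (d : ℕ)
    (A : Matrix (Fin n) (Fin m) R) (μ : Sym (Fin n) d) (ν : Sym (Fin m) d) :
    f (symPowMatrix d A μ ν) = symPowMatrix d (A.map f) μ ν := by
  rw [symPowMatrix, symPowMatrix, ← MvPolynomial.coeff_map, map_multiset_prod, Multiset.map_map]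
  simp

lemma symPowMatrix_smul {R : Type*} [CommRing R] {m n : ℕ} (d : ℕ) (c : R)
    (A : Matrix (Fin n) (Fin m) R) : symPowMatrix d (c • A) = c ^ d • symPowMatrix d A := by
  ext μ ν
  have : ∀ j, ∑ i, MvPolynomial.C ((c • A) i j) * MvPolynomial.X i =
      MvPolynomial.C c * ∑ i, MvPolynomial.C (A i j) * (MvPolynomial.X i : MvPolynomial (Fin n) R) :=
    fun j => by
      rw [Finset.mul_sum]
      simp [mul_assoc]
  rw [symPowMatrix, Matrix.smul_apply, symPowMatrix]
  simp only [this]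
  rw [Multiset.prod_map_mul, Multiset.map_const', Multiset.prod_replicate, Sym.card_coe, ← map_pow,
    MvPolynomial.coeff_C_mul, smul_eq_mul]

lemma mul_le_degree_of_mem {n m d r : ℕ} {e : Fin (min n m) →₀ ℕ}
    (he : MvPolynomial.monomial e (1 : ℤ) ∈ minorsIdeal r (symPowMatrix d (diagIndetMatrix n m))) :
    r * d ≤ e.sum fun _ v => v := by
  set ψ : MvPolynomial (Fin (min n m)) ℤ →+* Polynomial ℤ :=
    MvPolynomial.eval₂Hom Polynomial.C fun _ => Polynomial.X with hψ
  obtain ⟨D, hD⟩ : ∃ D : Matrix (Fin n) (Fin m) (Polynomial ℤ),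
      (diagIndetMatrix n m).map ψ = (Polynomial.X : Polynomial ℤ) • D := by
    refine ⟨Matrix.of fun i j => if (i : ℕ) = j then 1 else 0, ?_⟩
    ext1 i j
    rw [Matrix.map_apply, Matrix.smul_apply, Matrix.of_apply, diagIndetMatrix]
    split_ifs <;> simp [hψ]
  have hle : minorsIdeal r (symPowMatrix d (diagIndetMatrix n m)) ≤
      (Ideal.span {(Polynomial.X : Polynomial ℤ) ^ (r * d)}).comap ψ := by
    refine Ideal.span_le.mpr ?_
    rintro _ ⟨row, col, rfl⟩
    rw [SetLike.mem_coe, Ideal.mem_comap, Ideal.mem_span_singleton, RingHom.map_det]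
    have : ψ.mapMatrix ((symPowMatrix d (diagIndetMatrix n m)).submatrix row col) =
        (Polynomial.X : Polynomial ℤ) ^ d • (symPowMatrix d D).submatrix row col := by
      ext1 i j
      rw [RingHom.mapMatrix_apply, Matrix.map_apply, Matrix.submatrix_apply, map_symPowMatrix, hD,
        symPowMatrix_smul]
      rfl
    rw [this, Matrix.det_smul, Fintype.card_fin, ← pow_mul, mul_comm d]
    exact dvd_mul_right _ _
  have := hle he
  rw [Ideal.mem_comap, Ideal.mem_span_singleton, hψ, MvPolynomial.coe_eval₂Hom,
    MvPolynomial.eval₂_monomial, map_one, one_mul, Finsupp.prod, Finset.prod_pow_eq_pow_sum] at this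
  exact (pow_dvd_pow_iff Polynomial.X_ne_zero Polynomial.not_isUnit_X).mp this

/-- The minor of `S^d(Y)` on equal rows and columns is the product of the corresponding
monomials. -/
lemma monomial_mem_minorsIdeal {n m d r : ℕ} {s : Fin r → Sym (Fin (min n m)) d}
    (hs : Function.Injective s) :
    MvPolynomial.monomial (∑ k, Multiset.toFinsupp (s k : Multiset (Fin (min n m)))) (1 : ℤ) ∈
      minorsIdeal r (symPowMatrix d (diagIndetMatrix n m)) := by
  set ι := Fin.castLE (min_le_left n m)
  set κ := Fin.castLE (min_le_right n m)
  have hι : Function.Injective ι := Fin.castLE_injective _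
  have hentry : ∀ t u : Sym (Fin (min n m)) d,
      symPowMatrix d (diagIndetMatrix n m) (t.map ι) (u.map κ) =
        if t = u then MvPolynomial.monomial (Multiset.toFinsupp (u : Multiset (Fin (min n m)))) 1
        else 0 := by
    intro t u
    have hlin : ∀ j, ∑ i, MvPolynomial.C (diagIndetMatrix n m i (κ j)) * MvPolynomial.X i =
        MvPolynomial.C (MvPolynomial.X j) *
          (MvPolynomial.X (ι j) : MvPolynomial (Fin n) (MvPolynomial (Fin (min n m)) ℤ)) := by
      intro j
      rw [Finset.sum_eq_single (ι j)]
      · simp [diagIndetMatrix, ι, κ]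
      · intro i _ hi
        rw [diagIndetMatrix, dif_neg, map_zero, zero_mul]
        intro h
        exact hi (Fin.ext h)
      · simp
    have hX : ∀ {σ S : Type} [CommRing S] [DecidableEq σ] (v : Multiset σ),
        (v.map fun j => (MvPolynomial.X j : MvPolynomial σ S)).prod =
          MvPolynomial.monomial (Multiset.toFinsupp v) 1 := by
      intro σ S _ _ v
      induction v using Multiset.induction_on with
      | empty => simp
      | cons a v ih =>
        rw [Multiset.map_cons, Multiset.prod_cons, ih, ← Multiset.singleton_add, map_add,
          Multiset.toFinsupp_singleton, MvPolynomial.X, MvPolynomial.monomial_mul, one_mul]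
    rw [symPowMatrix, Sym.coe_map, Sym.coe_map, Multiset.map_map]
    simp only [Function.comp_def, hlin]
    have h2 : (Multiset.map (fun i => (MvPolynomial.X (ι i) :
        MvPolynomial (Fin n) (MvPolynomial (Fin (min n m)) ℤ)))
        (u : Multiset (Fin (min n m)))).prod =
        MvPolynomial.monomial (Multiset.toFinsupp (Multiset.map ι u)) 1 := by
      rw [← hX, Multiset.map_map]
      rfl
    have h3 : (Multiset.map (fun i => (MvPolynomial.C (MvPolynomial.X i) :
        MvPolynomial (Fin n) (MvPolynomial (Fin (min n m)) ℤ)))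
        (u : Multiset (Fin (min n m)))).prod =
        MvPolynomial.C (MvPolynomial.monomial (Multiset.toFinsupp u.1) 1) := by
      rw [← hX, map_multiset_prod, Multiset.map_map]
      rfl
    rw [Multiset.prod_map_mul, h2, h3, MvPolynomial.coeff_C_mul, MvPolynomial.coeff_monomial,
      mul_ite, mul_one, mul_zero]
    refine if_congr ?_ rfl rfl
    rw [Multiset.toFinsupp.injective.eq_iff, (Multiset.map_injective hι).eq_iff, Sym.coe_inj, eq_comm]
  refine Ideal.subset_span ⟨fun k => (s k).map ι, fun k => (s k).map κ, ?_⟩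
  have : (symPowMatrix d (diagIndetMatrix n m)).submatrix (fun k => (s k).map ι)
      (fun k => (s k).map κ) = Matrix.diagonal fun k =>
        MvPolynomial.monomial (Multiset.toFinsupp (s k : Multiset (Fin (min n m)))) 1 := by
    ext1 k l
    rw [Matrix.submatrix_apply, hentry, Matrix.diagonal_apply]
    by_cases h : k = l
    · simp [h]
    · simp [h, hs.ne h]
  rw [this, Matrix.det_diagonal, MvPolynomial.monomial_sum_one]

/-- The shape of a filling is the shape of the monomial recording its row lengths. -/
lemma monomialShape_eq_shape {X : Type*} [Fintype X] {N : ℕ} {p q : X → ℕ}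
    (hanti : Antitone fun c => (colorClass p c).card) (hq : ∀ c, Set.InjOn q (colorClass p c))
    (hqp : ∀ x, q x < (colorClass p (p x)).card) (hN : (colorClass p 0).card ≤ N)
    {e : Fin N →₀ ℕ} (he : ∀ i, e i = (colorClass q i).card) : monomialShape e = shape p := by
  classical
  have himage : ∀ c, (colorClass p c).image q = Finset.range (colorClass p c).card := fun c => by
    refine Finset.eq_of_subset_of_card_le (fun i hi => ?_) ?_
    · obtain ⟨x, hx, rfl⟩ := Finset.mem_image.mp hi
      obtain rfl := mem_colorClass.mp hx
      exact Finset.mem_range.mpr (hqp x)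
    · rw [Finset.card_range, Finset.card_image_of_injOn (hq c)]
  have hcols : ∀ i c, c ∈ (colorClass q i).image p ↔ i < (colorClass p c).card := fun i c => by
    rw [← Finset.mem_range, ← himage, Finset.mem_image, Finset.mem_image]
    simp only [mem_colorClass, and_comm]
  have hcard : ∀ i, ((colorClass q i).image p).card = (colorClass q i).card := fun i => by
    refine Finset.card_image_of_injOn fun x hx y hy hxy => ?_
    refine hq (p x) (mem_colorClass.mpr rfl) (mem_colorClass.mpr hxy.symm) ?_
    exact (mem_colorClass.mp hx).trans (mem_colorClass.mp hy).symm
  have hiff : ∀ (i : Fin N) k, k + 1 ≤ e i ↔ (i : ℕ) < (colorClass p k).card := fun i k => by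
    rw [he, ← hcard]
    constructor
    · intro h
      by_contra! hcon
      have : (colorClass q i).image p ⊆ Finset.range k := fun c hc => by
        rw [hcols] at hc
        rw [Finset.mem_range]
        by_contra! hkc
        exact absurd (hanti hkc) (by simp only; omega)
      have := Finset.card_le_card this
      rw [Finset.card_range] at this
      omega
    · intro h
      rw [← Finset.card_range (k + 1)]
      refine Finset.card_le_card fun c hc => ?_
      rw [Finset.mem_range] at hc
      exact (hcols _ _).mpr (h.trans_le (hanti (by omega)))
  have hle : ∀ k, (colorClass p k).card ≤ N := fun k => (hanti (Nat.zero_le k)).trans hN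
  have hk : ∀ k, (Finset.univ.filter fun j => k + 1 ≤ e j).card = (colorClass p k).card := fun k => by
    simp only [hiff]
    rw [Fin.card_filter_val_lt, min_eq_right (hle k)]
  rw [monomialShape, shape]
  simp only [hk, Multiset.filter_map]
  congr 1
  change (Finset.filter _ (Finset.range _)).val = _
  congr 1
  ext c
  simp only [Finset.mem_filter, Finset.mem_range, Function.comp_apply, Finset.mem_image,
    Finset.mem_univ, true_and]
  constructor
  · rintro ⟨-, hc⟩
    obtain ⟨x, hx⟩ := Finset.card_pos.mp hc
    exact ⟨x, mem_colorClass.mp hx⟩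
  · rintro ⟨x, rfl⟩
    have hpos : 0 < (colorClass p (p x)).card := Finset.card_pos.mpr ⟨x, mem_colorClass.mpr rfl⟩
    have h0 : 0 < N := hpos.trans_le (hle _)
    refine ⟨?_, hpos⟩
    have := (hiff ⟨0, h0⟩ (p x)).mpr hpos
    rw [Finsupp.sum_fintype _ _ fun _ => rfl]
    exact this.trans (Finset.single_le_sum (fun _ _ => Nat.zero_le _) (Finset.mem_univ _))

end Shapes

section GroupAlgebra

open Equiv

variable {X : Type*}

lemma swapEigen_smul {V : Type*} [DecidableEq X] [Fintype X] [AddCommGroup V] [Module ℚ V]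
    {ρ : Representation ℚ (Perm X) V} {χ : Perm X →* ℤˣ} {s : ℚ}
    (hχ : ∀ x y, x ≠ y → ((χ (swap x y) : ℤ) : ℚ) = s) {p : X → ℕ} {v : V}
    (hv : ∀ c, SwapEigen ρ s (colorClass p c) v) {g : Perm X} (hg : ∀ x, p (g x) = p x) :
    ρ g v = ((χ g : ℤ) : ℚ) • v := by
  induction hN : g.support.card using Nat.strong_induction_on generalizing g with
  | _ N ih =>
    by_cases h1 : g = 1
    · simp [h1]
    obtain ⟨x, hx⟩ : ∃ x, g x ≠ x := by
      by_contra! hcon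
      exact h1 (Equiv.ext hcon)
    have hx' : ∀ y, p (swap x (g x) y) = p y := fun y => by
      rw [swap_apply_def]
      split_ifs with h h'
      · rw [h, hg]
      · rw [h', hg]
      · rfl
    have h2 : ρ (swap x (g x) * g) v = ((χ (swap x (g x) * g) : ℤ) : ℚ) • v :=
      ih _ (hN ▸ Perm.card_support_swap_mul hx) (fun y => by rw [Perm.mul_apply, hx', hg]) rfl
    have h3 := hv (p x) x (mem_colorClass.mpr rfl) (g x) (mem_colorClass.mpr (hg x)) hx.symm
    have h4 : g = swap x (g x) * (swap x (g x) * g) := by rw [← mul_assoc, swap_mul_self, one_mul]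
    have h5 : ((χ g : ℤ) : ℚ) = s * ((χ (swap x (g x) * g) : ℤ) : ℚ) := by
      conv_lhs => rw [h4]
      rw [map_mul χ (swap x (g x)), Units.val_mul, Int.cast_mul, hχ _ _ hx.symm]
    conv_lhs => rw [h4]
    rw [map_mul, Module.End.mul_apply, h2, map_smul, h3, smul_smul, h5, mul_comm]

/-- The left regular representation on the group algebra. -/
def leftMul (X : Type*) : Representation ℚ (Perm X) (MonoidAlgebra ℚ (Perm X)) :=
  ((Algebra.lmul ℚ (MonoidAlgebra ℚ (Perm X)) : _ →ₐ[ℚ] _) : _ →* _).comp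
    (MonoidAlgebra.of ℚ (Perm X))

lemma leftMul_apply (g : Perm X) (x : MonoidAlgebra ℚ (Perm X)) :
    leftMul X g x = MonoidAlgebra.of ℚ _ g * x := rfl

variable [Fintype X] [DecidableEq X]

/-- The standard inner product on the group algebra. -/
def groupAlgebraInner (X : Type*) [Fintype X] [DecidableEq X] :
    MonoidAlgebra ℚ (Perm X) →ₗ[ℚ] MonoidAlgebra ℚ (Perm X) →ₗ[ℚ] ℚ :=
  LinearMap.mk₂ ℚ (fun x y => ∑ g, x.coeff g * y.coeff g)
    (fun x y z => by simp [add_mul, Finset.sum_add_distrib])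
    (fun c x y => by simp [Finset.mul_sum, mul_assoc])
    (fun x y z => by simp [mul_add, Finset.sum_add_distrib])
    (fun c x y => by simp [Finset.mul_sum, mul_left_comm])

lemma isInvariantInner_groupAlgebraInner :
    IsInvariantInner (leftMul X) (groupAlgebraInner X) where
  invariant g v w := by
    simp only [leftMul_apply, groupAlgebraInner, LinearMap.mk₂_apply, MonoidAlgebra.of_apply,
      MonoidAlgebra.coeff_single_mul_apply, one_mul]
    exact Equiv.sum_comp (Equiv.mulLeft g⁻¹) fun h => v.coeff h * w.coeff h
  symm v w := by
    simp only [groupAlgebraInner, LinearMap.mk₂_apply, mul_comm]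
  pos v hv := by
    obtain ⟨g, hg⟩ : ∃ g, v.coeff g ≠ 0 := by
      by_contra! hcon
      exact hv (MonoidAlgebra.ext (Finsupp.ext hcon))
    exact Finset.sum_pos' (fun h _ => mul_self_nonneg _)
      ⟨g, Finset.mem_univ _, mul_self_pos.mpr hg⟩

/-- The permutations preserving a colouring. -/
def colorPerms (p : X → ℕ) : Finset (Perm X) := {g | ∀ x, p (g x) = p x}

/-- The sum of the permutations preserving a colouring, twisted by a sign character. -/
def colorSum (χ : Perm X →* ℤˣ) (p : X → ℕ) : MonoidAlgebra ℚ (Perm X) :=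
  ∑ g ∈ colorPerms p, ((χ g : ℤ) : ℚ) • MonoidAlgebra.of ℚ _ g

lemma colorSum_mul_ne_zero {χ : Perm X →* ℤˣ} {s : ℚ}
    (hχ : ∀ x y, x ≠ y → ((χ (swap x y) : ℤ) : ℚ) = s) {p : X → ℕ} {v : MonoidAlgebra ℚ (Perm X)}
    (hv : ∀ c, SwapEigen (leftMul X) s (colorClass p c) v) (h0 : v ≠ 0) :
    colorSum χ p * v ≠ 0 := by
  have : colorSum χ p * v = ((colorPerms p).card : ℚ) • v := by
    rw [colorSum, Finset.sum_mul, Nat.cast_smul_eq_nsmul, ← Finset.sum_const]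
    refine Finset.sum_congr rfl fun g hg => ?_
    rw [smul_mul_assoc, ← leftMul_apply, swapEigen_smul hχ hv (Finset.mem_filter.mp hg).2, smul_smul,
      ← Int.cast_mul, ← Units.val_mul, Int.units_mul_self, Units.val_one, Int.cast_one, one_smul]
  rw [this]
  refine smul_ne_zero (Nat.cast_ne_zero.mpr (Finset.card_pos.mpr ⟨1, ?_⟩).ne') h0
  simp [colorPerms]

/-- The ideal of the group algebra generated by the column antisymmetrizers of the given shapes. -/
def columnIdeal (X : Type*) [Fintype X] [DecidableEq X] (S : Set (Multiset ℕ)) :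
    Submodule (MonoidAlgebra ℚ (Perm X)) (MonoidAlgebra ℚ (Perm X)) :=
  Submodule.span _ {x | ∃ (p : X → ℕ) (h : Perm X), shape p ∈ S ∧
    x = colorSum Perm.sign p * MonoidAlgebra.of ℚ _ h}

lemma mul_mem_columnIdeal {S : Set (Multiset ℕ)} {k : MonoidAlgebra ℚ (Perm X)}
    (hk : k ∈ columnIdeal X S) (x : MonoidAlgebra ℚ (Perm X)) : k * x ∈ columnIdeal X S := by
  induction x using MonoidAlgebra.induction_on with
  | of h =>
    induction hk using Submodule.span_induction with
    | mem k hk =>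
      obtain ⟨p, h', hp, rfl⟩ := hk
      exact Submodule.subset_span ⟨p, h' * h, hp, by rw [map_mul, mul_assoc]⟩
    | zero => simp
    | add x y _ _ hx hy => rw [add_mul]; exact add_mem hx hy
    | smul a x _ hx => rw [smul_mul_assoc]; exact Submodule.smul_mem _ a hx
  | add x y hx hy => rw [mul_add]; exact add_mem hx hy
  | smul c x hx => rw [mul_smul_comm]; exact Submodule.smul_of_tower_mem _ c hx

/-- An element of the group algebra belongs to the ideal generated by the column antisymmetrizers
of shapes in `S` as soon as it is killed by the row symmetrizers of all shapes not dominating an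
element of `S`. -/
theorem mem_columnIdeal {S : Set (Multiset ℕ)} {u : MonoidAlgebra ℚ (Perm X)}
    (hu : ∀ p q : X → ℕ, (Antitone fun c => (colorClass p c).card) →
      (∀ c, Set.InjOn q (colorClass p c)) → (∀ x, q x < (colorClass p (p x)).card) →
      (∃ g, colorSum 1 q * (MonoidAlgebra.of ℚ _ g * u) ≠ 0) →
      ∃ σ ∈ S, IsYoungDiagram σ ∧ youngGamma σ 1 = Fintype.card X ∧ YoungLE σ (shape p)) :
    u ∈ columnIdeal X S := by
  obtain ⟨M, hM⟩ := MonoidAlgebra.Submodule.exists_isCompl (columnIdeal X S)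
  have hKM : ∀ k ∈ columnIdeal X S, ∀ x ∈ M, k * x = 0 := fun k hk x hx =>
    Submodule.disjoint_def.mp hM.disjoint _ (mul_mem_columnIdeal hk x) (M.smul_mem k hx)
  obtain ⟨k, hk, x, hx, hkx⟩ := Submodule.mem_sup.mp
    (hM.sup_eq_top ▸ Submodule.mem_top : (1 : MonoidAlgebra ℚ (Perm X)) ∈ columnIdeal X S ⊔ M)
  by_cases hux : u * x = 0
  · rw [← mul_one u, ← hkx, mul_add, hux, add_zero]
    exact (columnIdeal X S).smul_mem u hk
  exfalso
  set M₁ : Submodule ℚ (MonoidAlgebra ℚ (Perm X)) :=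
    LinearMap.range (LinearMap.mulRight ℚ (u * x)) with hM₁
  have hM₁_ne : M₁ ≠ ⊥ := (Submodule.ne_bot_iff _).mpr ⟨u * x, ⟨1, one_mul _⟩, hux⟩
  have hM₁g : ∀ g, ∀ v ∈ M₁, leftMul X g v ∈ M₁ := by
    rintro g _ ⟨a, rfl⟩
    exact ⟨MonoidAlgebra.of ℚ _ g * a, by simp [leftMul_apply, mul_assoc]⟩
  have hM₁M : ∀ v ∈ M₁, v ∈ M := by
    rintro _ ⟨a, rfl⟩
    exact M.smul_mem a (M.smul_mem u hx)
  have hB := isInvariantInner_groupAlgebraInner (X := X)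
  obtain ⟨p, q, hp, ⟨v, ⟨a, rfl⟩, hv0, hv⟩, hanti, hinj, hlt⟩ := exists_columns_rows hB hM₁_ne hM₁g
  have hg : ∃ g, colorSum 1 q * (MonoidAlgebra.of ℚ _ g * u) ≠ 0 := by
    by_contra! hcon
    refine colorSum_mul_ne_zero (χ := 1) (s := 1) (by simp) hv hv0 ?_
    clear hv0 hv
    rw [LinearMap.mulRight_apply]
    induction a using MonoidAlgebra.induction_on with
    | of g => rw [← mul_assoc _ u, ← mul_assoc, hcon, zero_mul]
    | add y z hy hz => rw [add_mul, mul_add, hy, hz, add_zero]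
    | smul c y hy => rw [smul_mul_assoc, mul_smul_comm, hy, smul_zero]
  obtain ⟨σ, hσS, hσ, h1, hle⟩ := hu p q hanti hinj hlt hg
  obtain ⟨p', rfl, v, hvM, hv0, hv⟩ := hp.exists_shape_eq hB hM₁g hσ h1 hle
  refine colorSum_mul_ne_zero (χ := Perm.sign) (s := -1) (fun y z hyz => ?_) hv hv0
    (hKM _ (Submodule.subset_span ⟨p', 1, hσS, ?_⟩) v (hM₁M v hvM))
  · simp [Perm.sign_swap hyz]
  · rw [map_one, mul_one]

end GroupAlgebra

section TensorEval

open Equiv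

variable {R : Type*} [CommRing R] [Algebra ℚ R] {m n : ℕ} {X : Type*} [Fintype X]

/-- The matrix coefficients of the action of the group algebra on a tensor power of `φ`. -/
def tensorEval (φ : Matrix (Fin n) (Fin m) R) (i : X → Fin n) (j : X → Fin m) :
    MonoidAlgebra ℚ (Perm X) →ₗ[ℚ] R :=
  Finsupp.linearCombination ℚ (fun g : Perm X => ∏ x, φ (i (g x)) (j x)) ∘ₗ
    (MonoidAlgebra.coeffLinearEquiv ℚ : MonoidAlgebra ℚ (Perm X) ≃ₗ[ℚ] _).toLinearMap

variable (φ : Matrix (Fin n) (Fin m) R)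

lemma tensorEval_of (i : X → Fin n) (j : X → Fin m) (g : Perm X) :
    tensorEval φ i j (MonoidAlgebra.of ℚ _ g) = ∏ x, φ (i (g x)) (j x) := by
  simp [tensorEval]

lemma tensorEval_of_mul (i : X → Fin n) (j : X → Fin m) (g : Perm X)
    (x : MonoidAlgebra ℚ (Perm X)) :
    tensorEval φ i j (MonoidAlgebra.of ℚ _ g * x) = tensorEval φ (i ∘ g) j x := by
  induction x using MonoidAlgebra.induction_on with
  | of h =>
    rw [← map_mul, tensorEval_of, tensorEval_of]
    rfl
  | add x y hx hy => rw [mul_add, map_add, map_add, hx, hy]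
  | smul c x hx => rw [mul_smul_comm, map_smul, map_smul, hx]

lemma tensorEval_mul_of (i : X → Fin n) (j : X → Fin m) (h : Perm X)
    (x : MonoidAlgebra ℚ (Perm X)) :
    tensorEval φ i j (x * MonoidAlgebra.of ℚ _ h) = tensorEval φ i (j ∘ h.symm) x := by
  induction x using MonoidAlgebra.induction_on with
  | of g =>
    rw [← map_mul, tensorEval_of, tensorEval_of,
      ← Equiv.prod_comp h fun x => φ (i (g x)) ((j ∘ h.symm) x)]
    simp
  | add x y hx hy => rw [add_mul, map_add, map_add, hx, hy]
  | smul c x hx => rw [smul_mul_assoc, map_smul, map_smul, hx]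

variable [DecidableEq X]

lemma tensorEval_mem {S : Set (Multiset ℕ)} {J : Ideal R}
    (hS : ∀ p : X → ℕ, shape p ∈ S → ∀ i j, tensorEval φ i j (colorSum Perm.sign p) ∈ J)
    {x : MonoidAlgebra ℚ (Perm X)} (hx : x ∈ columnIdeal X S) (i : X → Fin n) (j : X → Fin m) :
    tensorEval φ i j x ∈ J := by
  induction hx using Submodule.span_induction generalizing i with
  | mem x hx =>
    obtain ⟨p, h, hp, rfl⟩ := hx
    rw [tensorEval_mul_of]
    exact hS p hp _ _
  | zero => simp
  | add x y _ _ hx hy => rw [map_add]; exact add_mem (hx i) (hy i)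
  | smul a x _ hx =>
    rw [smul_eq_mul]
    induction a using MonoidAlgebra.induction_on with
    | of g => rw [tensorEval_of_mul]; exact hx _
    | add a b ha hb => rw [add_mul, map_add]; exact add_mem ha hb
    | smul c a ha =>
      rw [smul_mul_assoc, map_smul, Algebra.smul_def]
      exact J.mul_mem_left _ ha

lemma tensorEval_colorSum_sign (p : X → ℕ) (i : X → Fin n) (j : X → Fin m) :
    tensorEval φ i j (colorSum Perm.sign p) = ∏ c ∈ Finset.univ.image p,
      (φ.submatrix (fun x : {x // p x = c} => i x) fun x : {x // p x = c} => j x).det := by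
  set B : Matrix X X R := Matrix.of fun x y => if p x = p y then φ (i x) (j y) else 0 with hB
  have hdet : tensorEval φ i j (colorSum Perm.sign p) = B.det := by
    rw [Matrix.det_apply, colorSum, map_sum, colorPerms, Finset.sum_filter]
    refine Finset.sum_congr rfl fun g _ => ?_
    split_ifs with hg
    · rw [map_smul, tensorEval_of, Int.cast_smul_eq_zsmul, Units.smul_def]
      simp [hB, hg]
    · obtain ⟨x, hx⟩ := not_forall.mp hg
      rw [Finset.prod_eq_zero (Finset.mem_univ x), smul_zero]
      simp [hB, hx]
  have hblock : B.BlockTriangular p := fun x y hxy => by simp [hB, hxy.ne']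
  rw [hdet, hblock.det]
  refine Finset.prod_congr rfl fun c _ => congrArg Matrix.det ?_
  ext ⟨x, hx⟩ ⟨y, hy⟩
  simp [Matrix.toSquareBlock, Matrix.toSquareBlockProp, hB, hx, hy]

omit [Algebra ℚ R] in
lemma det_submatrix_mem_minorsIdeal {N M Y : Type*} [Fintype Y] [DecidableEq Y]
    (A : Matrix N M R) (i : Y → N) (j : Y → M) :
    (A.submatrix i j).det ∈ minorsIdeal (Fintype.card Y) A := by
  refine Ideal.subset_span ⟨i ∘ (Fintype.equivFin Y).symm, j ∘ (Fintype.equivFin Y).symm, ?_⟩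
  rw [← Matrix.submatrix_submatrix, Matrix.det_submatrix_equiv_self]

omit [DecidableEq X] in
lemma card_subtype_eq_card_colorClass (p : X → ℕ) (c : ℕ) :
    Fintype.card {x // p x = c} = (colorClass p c).card := by
  rw [Fintype.card_subtype]
  rfl

lemma tensorEval_colorSum_sign_mem (p : X → ℕ) (i : X → Fin n) (j : X → Fin m) :
    tensorEval φ i j (colorSum Perm.sign p) ∈ prodMinorsIdeal φ (shape p) := by
  rw [tensorEval_colorSum_sign, prodMinorsIdeal, shape, Multiset.map_map]
  refine Ideal.prod_mem_prod fun c _ => ?_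
  rw [Function.comp_apply, ← card_subtype_eq_card_colorClass]
  exact det_submatrix_mem_minorsIdeal _ _ _

lemma tensorEval_colorSum_sign_eq_zero {p : X → ℕ} {s : ℕ} (hs : s ∈ shape p) (hlt : min n m < s)
    (i : X → Fin n) (j : X → Fin m) : tensorEval φ i j (colorSum Perm.sign p) = 0 := by
  obtain ⟨c, hc, rfl⟩ := Multiset.mem_map.mp hs
  rw [tensorEval_colorSum_sign]
  refine Finset.prod_eq_zero hc ?_
  rw [← card_subtype_eq_card_colorClass] at hlt
  rcases min_lt_iff.mp hlt with h | h
  · obtain ⟨x, y, hxy, he⟩ := Fintype.exists_ne_map_eq_of_card_lt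
      (fun x : {x // p x = c} => i x) (by simpa using h)
    refine Matrix.det_zero_of_row_eq hxy (funext fun z => ?_)
    rw [Matrix.submatrix_apply, Matrix.submatrix_apply, he]
  · obtain ⟨x, y, hxy, he⟩ := Fintype.exists_ne_map_eq_of_card_lt
      (fun x : {x // p x = c} => j x) (by simpa using h)
    refine Matrix.det_zero_of_column_eq hxy fun z => ?_
    rw [Matrix.submatrix_apply, Matrix.submatrix_apply, he]

end TensorEval

section RowSym

open Equiv

variable {r d : ℕ}

/-- Permutation of the rows of an `r × d` array. -/
def permRows (d : ℕ) (σ : Perm (Fin r)) : Perm (Fin r × Fin d) := prodCongr σ (Equiv.refl _)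

/-- Permutation of the entries within each row of an `r × d` array. -/
def permEntries (τ : Fin r → Perm (Fin d)) : Perm (Fin r × Fin d) := prodShear (Equiv.refl _) τ

lemma permEntries_mul (τ τ' : Fin r → Perm (Fin d)) :
    permEntries τ * permEntries τ' = permEntries (τ * τ') := rfl

lemma permRows_mul (σ σ' : Perm (Fin r)) :
    permRows d σ * permRows d σ' = permRows d (σ * σ') := rfl

lemma permRows_mul_permEntries (σ : Perm (Fin r)) (τ : Fin r → Perm (Fin d)) :
    permRows d σ * permEntries τ = permEntries (τ ∘ σ.symm) * permRows d σ := by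
  ext x <;> simp [permRows, permEntries]

/-- The sum of all permutations within the rows. -/
def entriesSum (r d : ℕ) : MonoidAlgebra ℚ (Perm (Fin r × Fin d)) :=
  ∑ τ : Fin r → Perm (Fin d), MonoidAlgebra.of ℚ _ (permEntries τ)

/-- The alternating sum of all permutations of the rows. -/
def rowsAlt (r d : ℕ) : MonoidAlgebra ℚ (Perm (Fin r × Fin d)) :=
  ∑ σ : Perm (Fin r), ((Perm.sign σ : ℤ) : ℚ) • MonoidAlgebra.of ℚ _ (permRows d σ)

lemma permEntries_mul_entriesSum (τ : Fin r → Perm (Fin d)) :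
    MonoidAlgebra.of ℚ _ (permEntries τ) * entriesSum r d = entriesSum r d := by
  rw [entriesSum, Finset.mul_sum, ← Equiv.sum_comp (Equiv.mulLeft τ)
    fun τ => MonoidAlgebra.of ℚ _ (permEntries τ)]
  refine Finset.sum_congr rfl fun τ' _ => ?_
  rw [← map_mul, permEntries_mul, Equiv.coe_mulLeft]

lemma permRows_mul_entriesSum (σ : Perm (Fin r)) :
    MonoidAlgebra.of ℚ _ (permRows d σ) * entriesSum r d =
      entriesSum r d * MonoidAlgebra.of ℚ _ (permRows d σ) := by
  rw [entriesSum, Finset.mul_sum, Finset.sum_mul,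
    ← Equiv.sum_comp (Equiv.arrowCongr σ (Equiv.refl (Perm (Fin d))))
      fun τ => MonoidAlgebra.of ℚ _ (permEntries τ) * MonoidAlgebra.of ℚ _ (permRows d σ)]
  refine Finset.sum_congr rfl fun τ _ => ?_
  rw [← map_mul, permRows_mul_permEntries, map_mul]
  rfl

lemma permRows_mul_rowsAlt (σ : Perm (Fin r)) :
    MonoidAlgebra.of ℚ _ (permRows d σ) * rowsAlt r d =
      ((Perm.sign σ : ℤ) : ℚ) • rowsAlt r d := by
  rw [rowsAlt, Finset.mul_sum, Finset.smul_sum, ← Equiv.sum_comp (Equiv.mulLeft σ)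
    fun σ' => ((Perm.sign σ : ℤ) : ℚ) • ((Perm.sign σ' : ℤ) : ℚ) •
      MonoidAlgebra.of ℚ _ (permRows d σ')]
  refine Finset.sum_congr rfl fun σ' _ => ?_
  rw [mul_smul_comm, ← map_mul, permRows_mul, Equiv.coe_mulLeft, smul_smul, map_mul, Units.val_mul,
    Int.cast_mul, ← mul_assoc, ← Int.cast_mul, ← Units.val_mul, Int.units_mul_self, Units.val_one,
    Int.cast_one, one_mul]

lemma exists_perm_of_map_eq {α : Type*} {a b : Fin d → α}
    (h : Finset.univ.val.map a = Finset.univ.val.map b) : ∃ t : Perm (Fin d), ∀ l, b (t l) = a l := by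
  classical
  have hcard : ∀ c, Fintype.card {l // a l = c} = Fintype.card {l // b l = c} := fun c => by
    rw [Fintype.card_subtype, Fintype.card_subtype]
    have := congrArg (Multiset.count c) h
    rw [Multiset.count_map, Multiset.count_map] at this
    simp only [eq_comm (a := c)] at this
    exact this
  exact ⟨Equiv.ofFiberEquiv fun c => Fintype.equivOfCardEq (hcard c),
    fun l => Equiv.ofFiberEquiv_map _ l⟩

/-- If some row symmetrizer does not kill `entriesSum * rowsAlt`, then the rows of the
corresponding filling are pairwise distinct as multisets. -/
lemma injective_rows_of_ne_zero {q : Fin r × Fin d → ℕ} {g : Perm (Fin r × Fin d)}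
    (hg : colorSum 1 q * (MonoidAlgebra.of ℚ _ g * (entriesSum r d * rowsAlt r d)) ≠ 0) :
    Function.Injective fun k => Finset.univ.val.map fun l => q (g (k, l)) := by
  intro k k' hkk'
  by_contra hne
  obtain ⟨t, ht⟩ := exists_perm_of_map_eq hkk'
  set τ : Fin r → Perm (Fin d) := Function.update (Function.update 1 k' t) k t⁻¹ with hτ
  set h : Perm (Fin r × Fin d) := permEntries τ * permRows d (swap k k') with hh
  have hu : MonoidAlgebra.of ℚ _ h * (entriesSum r d * rowsAlt r d) =
      -(entriesSum r d * rowsAlt r d) := by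
    rw [hh, map_mul, mul_assoc, ← mul_assoc _ (entriesSum r d), permRows_mul_entriesSum,
      mul_assoc (entriesSum r d), permRows_mul_rowsAlt, Perm.sign_swap hne, ← mul_assoc,
      permEntries_mul_entriesSum]
    simp
  have hq : ∀ x, q (g (h x)) = q (g x) := by
    rintro ⟨i, l⟩
    have hhil : h (i, l) = (swap k k' i, τ (swap k k' i) l) := rfl
    rw [hhil, hτ]
    rcases eq_or_ne i k with rfl | hik
    · rw [swap_apply_left, Function.update_of_ne (Ne.symm hne), Function.update_self, ht]
    rcases eq_or_ne i k' with rfl | hik'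
    · rw [swap_apply_right, Function.update_self, ← ht (t⁻¹ l), Perm.inv_def, apply_symm_apply]
    · rw [swap_apply_of_ne_of_ne hik hik', Function.update_of_ne hik, Function.update_of_ne hik']
      rfl
  have hsum : colorSum 1 q * MonoidAlgebra.of ℚ _ (g * h * g⁻¹) = colorSum 1 q := by
    have hmem : ∀ x, q ((g * h * g⁻¹) x) = q x := fun x => by
      rw [Perm.mul_apply, Perm.mul_apply, hq, Perm.inv_def, apply_symm_apply]
    rw [colorSum, Finset.sum_mul]
    refine Finset.sum_bij' (fun f _ => f * (g * h * g⁻¹)) (fun f _ => f * (g * h * g⁻¹)⁻¹)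
      (fun f hf => ?_) (fun f hf => ?_) (fun f _ => by group) (fun f _ => by group) fun f _ => ?_
    · simp only [colorPerms, Finset.mem_filter, Finset.mem_univ, true_and] at hf ⊢
      intro x
      rw [Perm.mul_apply, hf, hmem]
    · simp only [colorPerms, Finset.mem_filter, Finset.mem_univ, true_and] at hf ⊢
      intro x
      rw [Perm.mul_apply, hf, ← hmem, ← Perm.mul_apply, mul_inv_cancel, Perm.one_apply]
    · simp
  have := IsAddTorsionFree.of_module_rat (MonoidAlgebra ℚ (Perm (Fin r × Fin d)))
  refine hg (self_eq_neg.mp ?_)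
  calc colorSum 1 q * (MonoidAlgebra.of ℚ _ g * (entriesSum r d * rowsAlt r d))
      = colorSum 1 q * MonoidAlgebra.of ℚ _ (g * h * g⁻¹) *
          (MonoidAlgebra.of ℚ _ g * (entriesSum r d * rowsAlt r d)) := by rw [hsum]
    _ = colorSum 1 q * (MonoidAlgebra.of ℚ _ g *
          (MonoidAlgebra.of ℚ _ h * (entriesSum r d * rowsAlt r d))) := by
        rw [mul_assoc, ← mul_assoc (MonoidAlgebra.of ℚ _ (g * h * g⁻¹)), ← map_mul,
          inv_mul_cancel_right, map_mul, mul_assoc]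
    _ = _ := by rw [hu, mul_neg, mul_neg]

end RowSym

section Minors

open Equiv

variable {m n d r : ℕ}

lemma shape_mem_shapesOfSymPowMinors {p q : Fin r × Fin d → ℕ}
    (hanti : Antitone fun c => (colorClass p c).card) (hinj : ∀ c, Set.InjOn q (colorClass p c))
    (hlt : ∀ x, q x < (colorClass p (p x)).card) (hmin : (colorClass p 0).card ≤ min n m)
    {g : Perm (Fin r × Fin d)}
    (hg : Function.Injective fun k => Finset.univ.val.map fun l => q (g (k, l))) :
    shape p ∈ shapesOfSymPowMinors n m d r := by
  have hq : ∀ x, q x < min n m := fun x =>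
    (hlt x).trans_le ((hanti (Nat.zero_le _)).trans hmin)
  let a : Fin r → Fin d → Fin (min n m) := fun k l => ⟨q (g (k, l)), hq _⟩
  let s : Fin r → Sym (Fin (min n m)) d := fun k => ⟨Finset.univ.val.map (a k), by simp⟩
  have hs : Function.Injective s := fun k k' h => by
    refine hg ?_
    have := congrArg (Multiset.map Fin.val) (congrArg Subtype.val h)
    simpa only [s, Multiset.map_map, a, Function.comp_def] using this
  refine ⟨_, monomial_mem_minorsIdeal hs, (monomialShape_eq_shape hanti hinj hlt hmin ?_).symm⟩
  intro i
  rw [Finset.sum_apply']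
  have h1 : (colorClass q i).card = ∑ x, if q (g x) = i then 1 else 0 := by
    rw [colorClass, Finset.card_filter]
    exact (Equiv.sum_comp g fun x => if q x = (i : ℕ) then 1 else 0).symm
  rw [h1, Fintype.sum_prod_type]
  refine Finset.sum_congr rfl fun k _ => ?_
  rw [Multiset.toFinsupp_apply, ← Finset.card_filter]
  change Multiset.count i (Finset.univ.val.map (a k)) = _
  rw [Multiset.count_map]
  refine congrArg Multiset.card (Multiset.filter_congr fun l _ => ?_)
  rw [Fin.ext_iff, eq_comm]

/-- The shapes whose column antisymmetrizers generate the relevant ideal of the group algebra. -/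
def columnShapes (n m d r : ℕ) : Set (Multiset ℕ) :=
  minimalShapes n m d r ∪ {σ | ∃ s ∈ σ, min n m < s}

lemma entriesSum_mul_rowsAlt_mem :
    entriesSum r d * rowsAlt r d ∈ columnIdeal (Fin r × Fin d) (columnShapes n m d r) := by
  refine mem_columnIdeal fun p q hanti hinj hlt ⟨g, hg⟩ => ?_
  by_cases hmin : (colorClass p 0).card ≤ min n m
  · obtain ⟨σ, hσ, hle⟩ := exists_minimalShapes_youngLE
      (shape_mem_shapesOfSymPowMinors hanti hinj hlt hmin (injective_rows_of_ne_zero hg))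
    refine ⟨σ, Or.inl hσ, ?_⟩
    obtain ⟨⟨e, he, rfl⟩, -⟩ := hσ
    refine ⟨isYoungDiagram_monomialShape e, le_antisymm ?_ ?_, hle⟩
    · exact (hle 1 le_rfl).trans_eq (youngGamma_shape_one p)
    · rw [youngGamma_monomialShape_one, Fintype.card_prod, Fintype.card_fin, Fintype.card_fin]
      exact mul_le_degree_of_mem he
  · refine ⟨shape p, Or.inr ⟨_, Multiset.mem_map.mpr ⟨0, ?_, rfl⟩, not_le.mp hmin⟩,
      isYoungDiagram_shape p, youngGamma_shape_one p, fun _ _ => le_rfl⟩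
    obtain ⟨x, hx⟩ := Finset.card_pos.mp ((Nat.zero_le _).trans_lt (not_le.mp hmin))
    exact Finset.mem_image.mpr ⟨x, Finset.mem_univ _, mem_colorClass.mp hx⟩

variable {R : Type*} [CommRing R]

/-- A function `Fin d → Fin n` viewed as an element of the symmetric power. -/
def symOfFn (a : Fin d → Fin n) : Sym (Fin n) d := ⟨Finset.univ.val.map a, by simp⟩

lemma symOfFn_surjective : Function.Surjective (symOfFn : (Fin d → Fin n) → Sym (Fin n) d) := by
  rintro ⟨μ, hμ⟩
  induction μ using Quotient.inductionOn with
  | _ l =>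
    obtain rfl : l.length = d := hμ
    refine ⟨l.get, Subtype.ext ?_⟩
    change Finset.univ.val.map l.get = (l : Multiset (Fin n))
    rw [Fin.univ_val_map, List.ofFn_get]

lemma symPowMatrix_symOfFn (φ : Matrix (Fin n) (Fin m) R) (a : Fin d → Fin n)
    (b : Fin d → Fin m) : symPowMatrix d φ (symOfFn a) (symOfFn b) =
      ∑ f : Fin d → Fin n with symOfFn f = symOfFn a, ∏ l, φ (f l) (b l) := by
  have hb : ((symOfFn b : Sym (Fin m) d) : Multiset (Fin m)) = Finset.univ.val.map b := rfl
  rw [symPowMatrix, hb, Multiset.map_map]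
  change MvPolynomial.coeff (Multiset.toFinsupp (Finset.univ.val.map a))
    (∏ l, ∑ i, MvPolynomial.C (φ i (b l)) * MvPolynomial.X i) = _
  rw [Finset.prod_univ_sum, MvPolynomial.coeff_sum, Fintype.piFinset_univ, Finset.sum_filter]
  refine Finset.sum_congr rfl fun f _ => ?_
  have hX : ∏ l, (MvPolynomial.X (f l) : MvPolynomial (Fin n) R) =
      MvPolynomial.monomial (Multiset.toFinsupp (Finset.univ.val.map f)) 1 := by
    have : Finset.univ.val.map f = ∑ l, ({f l} : Multiset (Fin n)) :=
      by
      rw [Finset.sum, ← Multiset.sum_map_singleton (Finset.univ.val.map f), Multiset.map_map]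
      rfl
    rw [this, map_sum, MvPolynomial.monomial_sum_one]
    simp [MvPolynomial.X]
  rw [Finset.prod_mul_distrib, hX, ← map_prod, MvPolynomial.coeff_C_mul,
    MvPolynomial.coeff_monomial, mul_ite, mul_one, mul_zero]
  refine if_congr ?_ rfl rfl
  rw [Multiset.toFinsupp.injective.eq_iff]
  exact (Subtype.ext_iff (a1 := symOfFn f) (a2 := symOfFn a)).symm

/-- The number of permutations fixing a function. -/
def stabCard (a : Fin d → Fin n) : ℕ := Finset.card {t : Perm (Fin d) | a ∘ t = a}

lemma stabCard_pos (a : Fin d → Fin n) : 0 < stabCard a :=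
  Finset.card_pos.mpr ⟨1, by simp⟩

lemma sum_perm_eq_stabCard_mul (φ : Matrix (Fin n) (Fin m) R) (a : Fin d → Fin n)
    (b : Fin d → Fin m) : ∑ t : Perm (Fin d), ∏ l, φ (a (t l)) (b l) =
      stabCard a * symPowMatrix d φ (symOfFn a) (symOfFn b) := by
  have hmaps : ∀ t ∈ (Finset.univ : Finset (Perm (Fin d))),
      a ∘ t ∈ ({f | symOfFn f = symOfFn a} : Finset (Fin d → Fin n)) := fun t _ => by
    rw [Finset.mem_filter]
    refine ⟨Finset.mem_univ _, Subtype.ext ?_⟩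
    change Finset.univ.val.map (a ∘ t) = Finset.univ.val.map a
    rw [← Multiset.map_map]
    congr 1
    exact congrArg Finset.val (Finset.map_univ_equiv t)
  rw [symPowMatrix_symOfFn, Finset.mul_sum, ← Finset.sum_fiberwise_of_maps_to hmaps]
  refine Finset.sum_congr rfl fun f hf => ?_
  obtain ⟨t₀, ht₀⟩ := exists_perm_of_map_eq
    (congrArg Subtype.val (Finset.mem_filter.mp hf).2)
  have hconst : ∀ t ∈ ({t | a ∘ t = f} : Finset (Perm (Fin d))),
      ∏ l, φ (a (t l)) (b l) = ∏ l, φ (f l) (b l) := fun t ht => by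
    rw [← (Finset.mem_filter.mp ht).2]
    rfl
  rw [Finset.sum_congr rfl hconst, Finset.sum_const, nsmul_eq_mul]
  congr 2
  refine Finset.card_bij' (fun t _ => t * t₀⁻¹) (fun t _ => t * t₀) (fun t ht => ?_)
    (fun t ht => ?_) (fun t _ => by group) (fun t _ => by group)
  · simp only [Finset.mem_filter, Finset.mem_univ, true_and] at ht ⊢
    funext l
    have := congrFun ht (t₀⁻¹ l)
    rw [← ht₀, Perm.inv_def, apply_symm_apply] at this
    exact this
  · simp only [Finset.mem_filter, Finset.mem_univ, true_and] at ht ⊢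
    funext l
    rw [← ht₀]
    exact congrFun ht (t₀ l)

variable [Algebra ℚ R]

lemma tensorEval_entriesSum_mul_rowsAlt (φ : Matrix (Fin n) (Fin m) R) (i : Fin r → Fin d → Fin n)
    (j : Fin r → Fin d → Fin m) :
    tensorEval φ (fun x => i x.1 x.2) (fun x => j x.1 x.2) (entriesSum r d * rowsAlt r d) =
      (∏ k, (stabCard (i k) : R)) *
        ((symPowMatrix d φ).submatrix (fun k => symOfFn (i k)) fun k => symOfFn (j k)).det := by
  rw [← Matrix.det_mul_column, Matrix.det_apply, rowsAlt, Finset.mul_sum, map_sum]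
  refine Finset.sum_congr rfl fun σ _ => ?_
  rw [mul_smul_comm, map_smul, Int.cast_smul_eq_zsmul, Units.smul_def, tensorEval_mul_of, entriesSum,
    map_sum]
  congr 1
  simp only [tensorEval_of, Fintype.prod_prod_type, Matrix.of_apply, Matrix.submatrix_apply,
    ← sum_perm_eq_stabCard_mul]
  rw [← Equiv.prod_comp σ.symm, Finset.prod_univ_sum, Fintype.piFinset_univ]
  refine Finset.sum_congr rfl fun τ _ => Finset.prod_congr rfl fun k _ => ?_
  rw [Equiv.apply_symm_apply]
  rfl

end Minors

/-- Let `R` be a commutative ring containing `ℚ`, `φ : R^m → R^n` a linear map, `d ≥ 1`,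
`r ≥ 1`, and `Σ` the set of minimal shapes of monomials of `I_r(S^d(Y))` for a diagonal
matrix `Y` of indeterminates of the same format. Then `I_r(S^d(φ)) ⊆ Σ_{σ ∈ Σ} I^σ(φ)`. -/
theorem minors_symPow_subset_prodMinors {R : Type*} [CommRing R] [Algebra ℚ R] {m n : ℕ}
    (φ : Matrix (Fin n) (Fin m) R) (d r : ℕ) (hd : 1 ≤ d) (hr : 1 ≤ r) :
    minorsIdeal r (symPowMatrix d φ) ≤
      ⨆ σ ∈ minimalShapes n m d r, prodMinorsIdeal φ σ := by
  refine Ideal.span_le.mpr ?_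
  rintro _ ⟨row, col, rfl⟩
  choose i hi using fun k => symOfFn_surjective (row k)
  choose j hj using fun k => symOfFn_surjective (col k)
  obtain rfl : (fun k => symOfFn (i k)) = row := funext hi
  obtain rfl : (fun k => symOfFn (j k)) = col := funext hj
  have hmem := tensorEval_mem (J := ⨆ σ ∈ minimalShapes n m d r, prodMinorsIdeal φ σ) φ
    (fun p hp i j => ?_) (entriesSum_mul_rowsAlt_mem (n := n) (m := m) (d := d) (r := r))
    (fun x => i x.1 x.2) fun x => j x.1 x.2
  · rw [tensorEval_entriesSum_mul_rowsAlt] at hmem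
    refine (Ideal.unit_mul_mem_iff_mem _ ?_).mp hmem
    rw [← Nat.cast_prod, ← map_natCast (algebraMap ℚ R)]
    refine (IsUnit.mk0 _ ?_).map _
    exact Nat.cast_ne_zero.mpr (Finset.prod_ne_zero_iff.mpr fun k _ => (stabCard_pos _).ne')
  · rcases hp with hp | ⟨s, hs, hlt⟩
    · exact le_iSup₂ (f := fun σ _ => prodMinorsIdeal φ σ) _ hp
        (tensorEval_colorSum_sign_mem φ p i j)
    · rw [tensorEval_colorSum_sign_eq_zero φ hs hlt]
      exact zero_mem _
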